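/- Let a ≥ 3 be an integer. For every ε > 0 there exists N such that for all integers n ≥ N one has |γ² + (2a−1)·π²/6 − p_{n,2}/q_n| ≤ exp((a·(cos(2π/a) − 1) + ε)·n^{1−1/a}). -/

import Mathlib

/-- Generalized harmonic number `H_n^{(m)} = ∑_{j=1}^n 1/j^m`. -/
noncomputable def genHarmonic (m n : ℕ) : ℚ :=
  ∑ j ∈ Finset.range n, (1 : ℚ) / ((j : ℚ) + 1) ^ m

/-- `q_n = ∑_{k=0}^n C(n,k)^a · k!`. -/
noncomputable def qseq (a n : ℕ) : ℚ :=
  ∑ k ∈ Finset.range (n + 1), (n.choose k : ℚ) ^ a * (Nat.factorial k : ℚ)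

/-- `r_1(k) = a·H_{n-k} - (a-1)·H_k`. -/
noncomputable def r1 (a n k : ℕ) : ℚ :=
  (a : ℚ) * harmonic (n - k) - ((a : ℚ) - 1) * harmonic k

/-- `r_2(k) = a·H_{n-k}^{(2)} + (a-1)·H_k^{(2)}`. -/
noncomputable def r2 (a n k : ℕ) : ℚ :=
  (a : ℚ) * genHarmonic 2 (n - k) + ((a : ℚ) - 1) * genHarmonic 2 k

/-- `p_{n,2} = ∑_{k=0}^n C(n,k)^a · k! · (r_1(k)² + r_2(k))`. -/
noncomputable def pseq2 (a n : ℕ) : ℚ :=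
  ∑ k ∈ Finset.range (n + 1), (n.choose k : ℚ) ^ a * (Nat.factorial k : ℚ) *
    ((r1 a n k) ^ 2 + r2 a n k)

open Complex in
/-- The integral of `f` along the boundary of `[x₁, x₂] × [-Y, Y]`, counterclockwise. -/
noncomputable def rectIntegral (f : ℂ → ℂ) (x₁ x₂ Y : ℝ) : ℂ :=
  (∫ x : ℝ in x₁..x₂, f (x + (-Y : ℝ) * I)) - (∫ x : ℝ in x₁..x₂, f (x + Y * I)) +
    I * (∫ y : ℝ in (-Y)..Y, f (x₂ + y * I)) - I * (∫ y : ℝ in (-Y)..Y, f (x₁ + y * I))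

/-- The boundary of `[x₁, x₂] × [-Y, Y]`. -/
def rectBoundary (x₁ x₂ Y : ℝ) : Set ℂ :=
  {z | (z.re ∈ Set.uIcc x₁ x₂ ∧ |z.im| = Y) ∨ ((z.re = x₁ ∨ z.re = x₂) ∧ |z.im| ≤ Y)}

section rect

open Complex

variable {f g : ℂ → ℂ} {x₁ x₂ x₃ Y : ℝ}

lemma mem_rectBoundary_bot (hY : 0 ≤ Y) {x : ℝ} (hx : x ∈ Set.uIcc x₁ x₂) :
    (x + (-Y : ℝ) * I : ℂ) ∈ rectBoundary x₁ x₂ Y := by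
  left; simp [hx, abs_of_nonneg hY]

lemma mem_rectBoundary_top (hY : 0 ≤ Y) {x : ℝ} (hx : x ∈ Set.uIcc x₁ x₂) :
    (x + Y * I : ℂ) ∈ rectBoundary x₁ x₂ Y := by
  left; simp [hx, abs_of_nonneg hY]

lemma mem_rectBoundary_right (hY : 0 ≤ Y) {y : ℝ} (hy : y ∈ Set.uIcc (-Y) Y) :
    (x₂ + y * I : ℂ) ∈ rectBoundary x₁ x₂ Y := by
  rw [Set.uIcc_of_le (by linarith)] at hy
  right; simp [abs_le, hy.1, hy.2]

lemma mem_rectBoundary_left (hY : 0 ≤ Y) {y : ℝ} (hy : y ∈ Set.uIcc (-Y) Y) :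
    (x₁ + y * I : ℂ) ∈ rectBoundary x₁ x₂ Y := by
  rw [Set.uIcc_of_le (by linarith)] at hy
  right; simp [abs_le, hy.1, hy.2]

lemma rectIntegral_congr (hY : 0 ≤ Y) (h : Set.EqOn f g (rectBoundary x₁ x₂ Y)) :
    rectIntegral f x₁ x₂ Y = rectIntegral g x₁ x₂ Y := by
  unfold rectIntegral
  congr 1
  · congr 1
    · congr 1
      · exact intervalIntegral.integral_congr fun x hx => h (mem_rectBoundary_bot hY hx)
      · exact intervalIntegral.integral_congr fun x hx => h (mem_rectBoundary_top hY hx)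
    · congr 1
      exact intervalIntegral.integral_congr fun x hx => h (mem_rectBoundary_right hY hx)
  · congr 1
    exact intervalIntegral.integral_congr fun x hx => h (mem_rectBoundary_left hY hx)

lemma ContinuousOn.integrable_bot (hY : 0 ≤ Y) (hf : ContinuousOn f (rectBoundary x₁ x₂ Y)) :
    IntervalIntegrable (fun x : ℝ => f (x + (-Y : ℝ) * I)) MeasureTheory.volume x₁ x₂ :=
  (hf.comp (by fun_prop) fun _ hx => mem_rectBoundary_bot hY hx).intervalIntegrable

lemma ContinuousOn.integrable_top (hY : 0 ≤ Y) (hf : ContinuousOn f (rectBoundary x₁ x₂ Y)) :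
    IntervalIntegrable (fun x : ℝ => f (x + Y * I)) MeasureTheory.volume x₁ x₂ :=
  (hf.comp (by fun_prop) fun _ hx => mem_rectBoundary_top hY hx).intervalIntegrable

lemma ContinuousOn.integrable_right (hY : 0 ≤ Y) (hf : ContinuousOn f (rectBoundary x₁ x₂ Y)) :
    IntervalIntegrable (fun y : ℝ => f (x₂ + y * I)) MeasureTheory.volume (-Y) Y :=
  (hf.comp (by fun_prop) fun _ hx => mem_rectBoundary_right hY hx).intervalIntegrable

lemma ContinuousOn.integrable_left (hY : 0 ≤ Y) (hf : ContinuousOn f (rectBoundary x₁ x₂ Y)) :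
    IntervalIntegrable (fun y : ℝ => f (x₁ + y * I)) MeasureTheory.volume (-Y) Y :=
  (hf.comp (by fun_prop) fun _ hx => mem_rectBoundary_left hY hx).intervalIntegrable

lemma rectIntegral_add (hY : 0 ≤ Y) (hf : ContinuousOn f (rectBoundary x₁ x₂ Y))
    (hg : ContinuousOn g (rectBoundary x₁ x₂ Y)) :
    rectIntegral (fun z => f z + g z) x₁ x₂ Y =
      rectIntegral f x₁ x₂ Y + rectIntegral g x₁ x₂ Y := by
  unfold rectIntegral
  rw [intervalIntegral.integral_add (hf.integrable_bot hY) (hg.integrable_bot hY),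
    intervalIntegral.integral_add (hf.integrable_top hY) (hg.integrable_top hY),
    intervalIntegral.integral_add (hf.integrable_right hY) (hg.integrable_right hY),
    intervalIntegral.integral_add (hf.integrable_left hY) (hg.integrable_left hY)]
  ring

lemma rectIntegral_const_mul (c : ℂ) :
    rectIntegral (fun z => c * f z) x₁ x₂ Y = c * rectIntegral f x₁ x₂ Y := by
  unfold rectIntegral
  simp only [intervalIntegral.integral_const_mul]
  ring

lemma rectIntegral_adjacent (hY : 0 ≤ Y) (hf : ContinuousOn f (rectBoundary x₁ x₂ Y))
    (hg : ContinuousOn f (rectBoundary x₂ x₃ Y)) :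
    rectIntegral f x₁ x₃ Y = rectIntegral f x₁ x₂ Y + rectIntegral f x₂ x₃ Y := by
  unfold rectIntegral
  rw [← intervalIntegral.integral_add_adjacent_intervals (hf.integrable_bot hY)
    (hg.integrable_bot hY), ← intervalIntegral.integral_add_adjacent_intervals
    (hf.integrable_top hY) (hg.integrable_top hY)]
  ring

lemma rectIntegral_of_differentiable (h : x₁ ≤ x₂) (hY : 0 ≤ Y)
    (hf : ∀ z : ℂ, z.re ∈ Set.Icc x₁ x₂ → |z.im| ≤ Y → DifferentiableAt ℂ f z) :
    rectIntegral f x₁ x₂ Y = 0 := by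
  have := Complex.integral_boundary_rect_eq_zero_of_differentiableOn f (⟨x₁, -Y⟩ : ℂ) ⟨x₂, Y⟩ ?_
  · simpa [rectIntegral] using this
  · intro z hz
    rw [Complex.mem_reProdIm] at hz
    simp only [Set.uIcc_of_le h, Set.uIcc_of_le (by linarith : -Y ≤ Y)] at hz
    exact (hf z hz.1 (abs_le.2 hz.2)).differentiableWithinAt

lemma rectIntegral_of_hasDerivAt (hY : 0 ≤ Y)
    (hf : ∀ z ∈ rectBoundary x₁ x₂ Y, HasDerivAt f (g z) z)
    (hg : ContinuousOn g (rectBoundary x₁ x₂ Y)) :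
    rectIntegral g x₁ x₂ Y = 0 := by
  have hor : ∀ (t : ℝ) (x : ℝ), HasDerivAt f (g (x + t * I)) (x + t * I : ℂ) →
      HasDerivAt (fun x : ℝ => f (x + t * I)) (g (x + t * I)) x := by
    intro t x h
    have h2 : HasDerivAt (fun x : ℝ => (x + t * I : ℂ)) 1 x :=
      (Complex.ofRealCLM.hasDerivAt (x := x)).add_const _
    have h3 := h.comp x h2
    rw [mul_one] at h3
    exact h3
  have ver : ∀ (t : ℝ) (y : ℝ), HasDerivAt f (g (t + y * I)) (t + y * I : ℂ) →
      HasDerivAt (fun y : ℝ => -I * f (t + y * I)) (g (t + y * I)) y := by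
    intro t y h
    have h2 : HasDerivAt (fun y : ℝ => (t + y * I : ℂ)) (1 * I) y :=
      ((Complex.ofRealCLM.hasDerivAt (x := y)).mul_const I).const_add _
    have h3 := (h.comp y h2).const_mul (-I)
    rw [show -I * (g (t + y * I) * (1 * I)) = g (t + y * I) by
      linear_combination (-g (t + y * I)) * I_sq] at h3
    exact h3
  unfold rectIntegral
  rw [intervalIntegral.integral_eq_sub_of_hasDerivAt
      (fun x hx => hor (-Y) x (hf _ (mem_rectBoundary_bot hY hx))) (hg.integrable_bot hY),
    intervalIntegral.integral_eq_sub_of_hasDerivAt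
      (fun x hx => hor Y x (hf _ (mem_rectBoundary_top hY hx))) (hg.integrable_top hY),
    intervalIntegral.integral_eq_sub_of_hasDerivAt
      (fun x hx => ver x₂ x (hf _ (mem_rectBoundary_right hY hx))) (hg.integrable_right hY),
    intervalIntegral.integral_eq_sub_of_hasDerivAt
      (fun x hx => ver x₁ x (hf _ (mem_rectBoundary_left hY hx))) (hg.integrable_left hY)]
  linear_combination (-f (x₂ + Y * I) + f (x₂ + (-Y : ℝ) * I) + f (x₁ + Y * I)
    - f (x₁ + (-Y : ℝ) * I)) * I_sq

lemma norm_rectIntegral_le (h : x₁ ≤ x₂) (hY : 0 ≤ Y) {B : ℝ}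
    (hf : ∀ z ∈ rectBoundary x₁ x₂ Y, ‖f z‖ ≤ B) :
    ‖rectIntegral f x₁ x₂ Y‖ ≤ (2 * (x₂ - x₁) + 4 * Y) * B := by
  have h1 := intervalIntegral.norm_integral_le_of_norm_le_const (a := x₁) (b := x₂)
    (f := fun x : ℝ => f (x + (-Y : ℝ) * I)) (C := B)
    fun x hx => hf _ (mem_rectBoundary_bot hY (Set.uIoc_subset_uIcc hx))
  have h2 := intervalIntegral.norm_integral_le_of_norm_le_const (a := x₁) (b := x₂)
    (f := fun x : ℝ => f (x + Y * I)) (C := B)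
    fun x hx => hf _ (mem_rectBoundary_top hY (Set.uIoc_subset_uIcc hx))
  have h3 := intervalIntegral.norm_integral_le_of_norm_le_const (a := -Y) (b := Y)
    (f := fun x : ℝ => f (x₂ + x * I)) (C := B)
    fun x hx => hf _ (mem_rectBoundary_right hY (Set.uIoc_subset_uIcc hx))
  have h4 := intervalIntegral.norm_integral_le_of_norm_le_const (a := -Y) (b := Y)
    (f := fun x : ℝ => f (x₁ + x * I)) (C := B)
    fun x hx => hf _ (mem_rectBoundary_left hY (Set.uIoc_subset_uIcc hx))
  rw [abs_of_nonneg (by linarith)] at h1 h2 h3 h4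
  unfold rectIntegral
  refine (norm_sub_le _ _).trans ?_
  refine (add_le_add (norm_add_le _ _) le_rfl).trans ?_
  refine (add_le_add (add_le_add (norm_sub_le _ _) le_rfl) le_rfl).trans ?_
  simp only [norm_mul, norm_I, one_mul]
  linarith

end rect

section cot

open Complex

/-- `π cot (π z)`. -/
noncomputable def piCot (z : ℂ) : ℂ := Real.pi * cos (Real.pi * z) / sin (Real.pi * z)

/-- The derivative of `π cot (π z)`. -/
noncomputable def piCot' (z : ℂ) : ℂ := -Real.pi ^ 2 / sin (Real.pi * z) ^ 2

/-- The second derivative of `π cot (π z)`. -/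
noncomputable def piCot'' (z : ℂ) : ℂ :=
  2 * Real.pi ^ 3 * cos (Real.pi * z) / sin (Real.pi * z) ^ 3

lemma norm_cexp_mul_I (w : ℂ) : ‖exp (w * I)‖ = Real.exp (-w.im) := by
  rw [Complex.norm_exp]; simp

lemma norm_cexp_neg_mul_I (w : ℂ) : ‖exp (-w * I)‖ = Real.exp w.im := by
  rw [Complex.norm_exp]; simp

lemma norm_cos_le (w : ℂ) : ‖cos w‖ ≤ Real.exp |w.im| := by
  have h1 : ‖exp (w * I)‖ ≤ Real.exp |w.im| := by
    rw [norm_cexp_mul_I]; exact Real.exp_le_exp.2 (neg_le_abs _)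
  have h2 : ‖exp (-w * I)‖ ≤ Real.exp |w.im| := by
    rw [norm_cexp_neg_mul_I]; exact Real.exp_le_exp.2 (le_abs_self _)
  have h3 := norm_add_le (exp (w * I)) (exp (-w * I))
  rw [Complex.cos, norm_div, Complex.norm_ofNat]
  linarith

lemma norm_sin_le (w : ℂ) : ‖sin w‖ ≤ Real.exp |w.im| := by
  have := norm_cos_le (w - Real.pi / 2)
  rw [Complex.cos_sub_pi_div_two] at this
  have e : (w - Real.pi / 2).im = w.im := by
    have : ((Real.pi : ℂ) / 2).im = 0 := by
      rw [show (Real.pi : ℂ) / 2 = ((Real.pi / 2 : ℝ) : ℂ) by push_cast; rfl, ofReal_im]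
    rw [sub_im, this, sub_zero]
  rwa [e] at this

lemma abs_sinh_im_le_norm_sin (w : ℂ) : Real.sinh |w.im| ≤ ‖sin w‖ := by
  have h := abs_norm_sub_norm_le (exp (-w * I)) (exp (w * I))
  rw [norm_cexp_neg_mul_I, norm_cexp_mul_I] at h
  have e : Real.sinh |w.im| = |Real.exp w.im - Real.exp (-w.im)| / 2 := by
    rw [← Real.abs_sinh, Real.sinh_eq, abs_div, abs_two]
  rw [e, Complex.sin, norm_div, norm_mul, norm_I, mul_one, Complex.norm_ofNat]
  linarith

lemma norm_sin_pi_half_int (k : ℤ) (y : ℝ) :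
    ‖sin (Real.pi * ((k : ℂ) - 1 / 2 + y * I))‖ = Real.cosh (Real.pi * y) := by
  have e : (Real.pi * ((k : ℂ) - 1 / 2 + y * I) : ℂ) =
      (Real.pi * y : ℝ) * I - Real.pi / 2 + k * Real.pi := by push_cast; ring
  have hc : ‖cos (k * Real.pi)‖ = 1 := by
    have hc := Complex.cos_sq_add_sin_sq (k * Real.pi)
    rw [Complex.sin_int_mul_pi, zero_pow two_ne_zero, add_zero] at hc
    rw [← sq_eq_sq₀ (norm_nonneg _) zero_le_one, ← norm_pow, hc]
    simp
  rw [e, Complex.sin_add, Complex.sin_int_mul_pi, mul_zero, add_zero, norm_mul, hc, mul_one,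
    Complex.sin_sub_pi_div_two, Complex.cos_mul_I, ← Complex.ofReal_cosh]
  simp only [norm_neg, norm_real, Real.norm_eq_abs, abs_of_pos (Real.cosh_pos _)]

/-- Lower bound for `sin (π z)` away from the real axis or on half-integral abscissae. -/
lemma exp_le_norm_sin_pi {z : ℂ} (h : 1 ≤ |z.im| ∨ ∃ k : ℤ, z.re = k - 1 / 2) :
    Real.exp (Real.pi * |z.im|) / 4 ≤ ‖sin (Real.pi * z)‖ := by
  rcases h with h | ⟨k, hk⟩
  · refine le_trans ?_ (abs_sinh_im_le_norm_sin _)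
    have e : |(Real.pi * z : ℂ).im| = Real.pi * |z.im| := by
      rw [Complex.im_ofReal_mul, abs_mul, abs_of_pos Real.pi_pos]
    rw [e, Real.sinh_eq]
    have h3 : (3 : ℝ) ≤ Real.pi * |z.im| := by nlinarith [Real.pi_gt_three]
    have h4 := Real.add_one_le_exp (Real.pi * |z.im|)
    have h5 : Real.exp (-(Real.pi * |z.im|)) ≤ 1 := Real.exp_le_one_iff.2 (by linarith)
    linarith
  · have e : z = (k : ℂ) - 1 / 2 + z.im * I := by
      apply Complex.ext <;> simp [hk]
    have := norm_sin_pi_half_int k z.im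
    rw [← e] at this
    rw [this, ← Real.cosh_abs, abs_mul, abs_of_pos Real.pi_pos, Real.cosh_eq]
    have := Real.exp_pos (Real.pi * |z.im|)
    have := Real.exp_pos (-(Real.pi * |z.im|))
    linarith

lemma norm_cos_pi_le (z : ℂ) : ‖cos (Real.pi * z)‖ ≤ Real.exp (Real.pi * |z.im|) := by
  have := norm_cos_le (Real.pi * z)
  rwa [Complex.im_ofReal_mul, abs_mul, abs_of_pos Real.pi_pos] at this

lemma norm_sin_pi_le (z : ℂ) : ‖sin (Real.pi * z)‖ ≤ Real.exp (Real.pi * |z.im|) := by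
  have := norm_sin_le (Real.pi * z)
  rwa [Complex.im_ofReal_mul, abs_mul, abs_of_pos Real.pi_pos] at this

lemma norm_piCot'_le {z : ℂ} (h : 1 ≤ |z.im| ∨ ∃ k : ℤ, z.re = k - 1 / 2) :
    ‖piCot' z‖ ≤ 16 * Real.pi ^ 2 * Real.exp (-(2 * Real.pi * |z.im|)) := by
  have h1 := exp_le_norm_sin_pi h
  set E := Real.exp (Real.pi * |z.im|) with hE
  have hE0 : 0 < E := Real.exp_pos _
  have e : Real.exp (-(2 * Real.pi * |z.im|)) = (E ^ 2)⁻¹ := by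
    rw [hE, ← Real.exp_nat_mul, ← Real.exp_neg]; congr 1; push_cast; ring
  rw [e, piCot', norm_div, norm_pow, norm_neg, norm_pow, norm_real, Real.norm_eq_abs,
    abs_of_pos Real.pi_pos]
  calc _ ≤ Real.pi ^ 2 / (E / 4) ^ 2 := by gcongr
    _ = _ := by field_simp; ring

lemma norm_piCot''_le {z : ℂ} (h : 1 ≤ |z.im| ∨ ∃ k : ℤ, z.re = k - 1 / 2) :
    ‖piCot'' z‖ ≤ 128 * Real.pi ^ 3 * Real.exp (-(2 * Real.pi * |z.im|)) := by
  have h1 := exp_le_norm_sin_pi h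
  have h2 := norm_cos_pi_le z
  set E := Real.exp (Real.pi * |z.im|) with hE
  have hE0 : 0 < E := Real.exp_pos _
  have e : Real.exp (-(2 * Real.pi * |z.im|)) = (E ^ 2)⁻¹ := by
    rw [hE, ← Real.exp_nat_mul, ← Real.exp_neg]; congr 1; push_cast; ring
  rw [e, piCot'', norm_div, norm_pow, norm_mul, norm_mul, norm_pow, norm_real, Real.norm_eq_abs,
    abs_of_pos Real.pi_pos, Complex.norm_ofNat]
  calc _ ≤ 2 * Real.pi ^ 3 * E / (E / 4) ^ 3 := by gcongr
    _ = _ := by field_simp; ring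

lemma sin_pi_ne_zero {z : ℂ} (h : z.im ≠ 0 ∨ ∃ k : ℤ, z.re = k - 1 / 2) :
    sin (Real.pi * z) ≠ 0 := by
  rcases h with h | ⟨k, hk⟩
  · intro h0
    have := abs_sinh_im_le_norm_sin (Real.pi * z)
    rw [h0, norm_zero, ← not_lt, Complex.im_ofReal_mul] at this
    exact this (Real.sinh_pos_iff.2 (abs_pos.2 (mul_ne_zero Real.pi_ne_zero h)))
  · have := exp_le_norm_sin_pi (Or.inr ⟨k, hk⟩)
    intro h0
    rw [h0, norm_zero] at this
    have := Real.exp_pos (Real.pi * |z.im|)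
    linarith

lemma rectBoundary_half_int {A B : ℤ} {Y : ℝ} {z : ℂ}
    (hz : z ∈ rectBoundary (A - 1 / 2) (B - 1 / 2) Y) :
    |z.im| = Y ∨ ∃ k : ℤ, z.re = k - 1 / 2 := by
  rcases hz with h | h
  · exact Or.inl h.2
  · rcases h.1 with h | h
    · exact Or.inr ⟨A, h⟩
    · exact Or.inr ⟨B, h⟩

lemma sin_pi_ne_zero_of_mem {A B : ℤ} {Y : ℝ} (hY : 0 < Y) {z : ℂ}
    (hz : z ∈ rectBoundary (A - 1 / 2) (B - 1 / 2) Y) : sin (Real.pi * z) ≠ 0 := by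
  refine sin_pi_ne_zero ?_
  rcases rectBoundary_half_int hz with h | h
  · left; intro h0; rw [h0, abs_zero] at h; exact hY.ne h
  · exact Or.inr h

lemma hasDerivAt_sin_pi (z : ℂ) :
    HasDerivAt (fun z : ℂ => sin (Real.pi * z)) (Real.pi * cos (Real.pi * z)) z := by
  have h : HasDerivAt (fun z : ℂ => (Real.pi : ℂ) * z) Real.pi z := by
    simpa using (hasDerivAt_id z).const_mul (Real.pi : ℂ)
  rw [mul_comm (Real.pi : ℂ) (cos _)]
  exact h.csin

lemma hasDerivAt_cos_pi (z : ℂ) :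
    HasDerivAt (fun z : ℂ => cos (Real.pi * z)) (-Real.pi * sin (Real.pi * z)) z := by
  have h : HasDerivAt (fun z : ℂ => (Real.pi : ℂ) * z) Real.pi z := by
    simpa using (hasDerivAt_id z).const_mul (Real.pi : ℂ)
  rw [show (-Real.pi * sin (Real.pi * z) : ℂ) = -sin (Real.pi * z) * Real.pi by ring]
  exact h.ccos

lemma hasDerivAt_piCot {z : ℂ} (h : sin (Real.pi * z) ≠ 0) :
    HasDerivAt piCot (piCot' z) z := by
  have := ((hasDerivAt_cos_pi z).const_mul (Real.pi : ℂ)).div (hasDerivAt_sin_pi z) h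
  convert! this using 1
  rw [piCot']
  congr 1
  linear_combination (Real.pi : ℂ) ^ 2 * Complex.sin_sq_add_cos_sq (Real.pi * z)

lemma hasDerivAt_piCot' {z : ℂ} (h : sin (Real.pi * z) ≠ 0) :
    HasDerivAt piCot' (piCot'' z) z := by
  have := (hasDerivAt_const z (-Real.pi ^ 2 : ℂ)).div ((hasDerivAt_sin_pi z).pow 2)
    (pow_ne_zero 2 h)
  convert! this using 1
  rw [piCot'']
  simp only [Pi.pow_apply]
  field_simp
  push_cast
  ring

/-- The integral of `π cot (π z)` over a unit horizontal segment in the upper half plane. -/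
lemma integral_piCot_top (x₁ : ℝ) {Y : ℝ} (hY : 0 < Y) :
    ∫ x : ℝ in x₁..(x₁ + 1), piCot (x + Y * I) = -Real.pi * I := by
  have hq : ∀ x : ℝ, ‖exp (2 * Real.pi * I * (x + Y * I))‖ < 1 := by
    intro x
    rw [Complex.norm_exp, Real.exp_lt_one_iff]
    have : (2 * Real.pi * I * (x + Y * I)).re = -(2 * Real.pi * Y) := by simp
    rw [this]
    have := Real.pi_pos
    nlinarith [mul_pos this hY]
  have hd : ∀ x : ℝ, HasDerivAt (fun x : ℝ => -Real.pi * I * (x + Y * I) +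
      log (1 - exp (2 * Real.pi * I * (x + Y * I)))) (piCot (x + Y * I)) x := by
    intro x
    have h0 : HasDerivAt (fun x : ℝ => (x + Y * I : ℂ)) 1 x :=
      (Complex.ofRealCLM.hasDerivAt (x := x)).add_const _
    have hs : 1 - exp (2 * Real.pi * I * (x + Y * I)) ∈ slitPlane := by
      left
      rw [sub_re, one_re]
      linarith [(Complex.abs_re_le_norm _).trans_lt (hq x),
        le_abs_self (exp (2 * Real.pi * I * (x + Y * I))).re]
    have h1 := (h0.const_mul (2 * Real.pi * I)).cexp.const_sub 1
    have h2 := (h0.const_mul (-Real.pi * I)).add (h1.clog_real hs)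
    convert! h2 using 1
    have hne := slitPlane_ne_zero hs
    have e1 : exp (2 * Real.pi * I * (x + Y * I)) =
        exp (Real.pi * (x + Y * I) * I) * exp (Real.pi * (x + Y * I) * I) := by
      rw [← Complex.exp_add]; congr 1; ring
    have e2 : exp (-(Real.pi * (x + Y * I)) * I) = (exp (Real.pi * (x + Y * I) * I))⁻¹ := by
      rw [← Complex.exp_neg]; congr 1; ring
    rw [piCot, Complex.cos, Complex.sin, e2]
    rw [e1] at hne ⊢
    set E := exp (Real.pi * (x + Y * I) * I)
    have hE : E ≠ 0 := Complex.exp_ne_zero _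
    have hne' : E⁻¹ - E ≠ 0 := by
      intro h
      apply hne
      have : E * (E⁻¹ - E) = 1 - E * E := by field_simp
      rw [← this, h, mul_zero]
    have e3 : E⁻¹ - E = E⁻¹ * (1 - E * E) := by field_simp
    have e4 : E + E⁻¹ = E⁻¹ * (1 + E * E) := by field_simp; ring
    rw [e3, e4]
    obtain ⟨D, hD⟩ : ∃ D, D = 1 - E * E := ⟨_, rfl⟩
    rw [← hD] at hne ⊢
    rw [show 1 + E * E = 2 - D by rw [hD]; ring, show E * E = 1 - D by rw [hD]; ring]
    have hI := I_ne_zero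
    field_simp
    linear_combination (2 - D) * I_sq
  have hcont : Continuous fun x : ℝ => piCot (x + Y * I) := by
    unfold piCot
    refine Continuous.div (by fun_prop) (by fun_prop) fun x => ?_
    exact sin_pi_ne_zero (Or.inl (by simpa using hY.ne'))
  rw [intervalIntegral.integral_eq_sub_of_hasDerivAt (fun x _ => hd x)
    (hcont.intervalIntegrable _ _)]
  have e : exp (2 * Real.pi * I * ((x₁ + 1 : ℝ) + Y * I)) =
      exp (2 * Real.pi * I * (x₁ + Y * I)) := by
    rw [show (2 * Real.pi * I * ((x₁ + 1 : ℝ) + Y * I) : ℂ) =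
      2 * Real.pi * I * (x₁ + Y * I) + 2 * Real.pi * I by push_cast; ring, Complex.exp_add,
      Complex.exp_two_pi_mul_I, mul_one]
  rw [e]
  push_cast
  ring

lemma piCot_neg (z : ℂ) : piCot (-z) = -piCot z := by
  simp [piCot, div_neg]

lemma piCot_add_one (z : ℂ) : piCot (z + 1) = piCot z := by
  rw [piCot, piCot, mul_add, mul_one, Complex.cos_add_pi, Complex.sin_add_pi]
  simp [neg_div_neg_eq]

lemma rectIntegral_piCot (x₁ : ℝ) {Y : ℝ} (hY : 0 < Y) :
    rectIntegral piCot x₁ (x₁ + 1) Y = 2 * Real.pi * I := by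
  have h1 := integral_piCot_top x₁ hY
  have h2 : ∫ x : ℝ in x₁..(x₁ + 1), piCot (x + (-Y : ℝ) * I) = Real.pi * I := by
    have h := integral_piCot_top (-(x₁ + 1)) hY
    rw [show -(x₁ + 1) + 1 = -x₁ by ring,
      ← intervalIntegral.integral_comp_neg (fun x : ℝ => piCot (x + Y * I))] at h
    rw [← neg_inj, ← intervalIntegral.integral_neg]
    rw [show -(Real.pi * I : ℂ) = -Real.pi * I by ring, ← h]
    refine intervalIntegral.integral_congr fun x _ => ?_
    change -piCot (x + (-Y : ℝ) * I) = piCot ((-x : ℝ) + Y * I)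
    rw [← piCot_neg]; congr 1; push_cast; ring
  have h3 : ∫ y : ℝ in (-Y)..Y, piCot ((x₁ + 1 : ℝ) + y * I) =
      ∫ y : ℝ in (-Y)..Y, piCot (x₁ + y * I) := by
    refine intervalIntegral.integral_congr fun y _ => ?_
    rw [← piCot_add_one (x₁ + y * I)]; congr 1; push_cast; ring
  rw [rectIntegral, h1, h2, h3]
  ring

variable {F : ℂ → ℂ}

lemma continuousOn_piCot {A B : ℤ} {Y : ℝ} (hY : 0 < Y) :
    ContinuousOn piCot (rectBoundary (A - 1 / 2) (B - 1 / 2) Y) := fun _ hz =>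
  (hasDerivAt_piCot (sin_pi_ne_zero_of_mem hY hz)).continuousAt.continuousWithinAt

lemma rectIntegral_mul_piCot_cell (hF : Differentiable ℂ F) (k : ℤ) {Y : ℝ} (hY : 0 < Y) :
    rectIntegral (fun z => F z * piCot z) (k - 1 / 2) ((k + 1 : ℤ) - 1 / 2) Y =
      2 * Real.pi * I * F k := by
  have hdF : Differentiable ℂ (dslope F k) := by
    rw [← differentiableOn_univ] at hF ⊢
    exact (Complex.differentiableOn_dslope Filter.univ_mem).2 hF
  set S : ℂ → ℂ := fun z => sin (Real.pi * z) with hS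
  have hdS : Differentiable ℂ (dslope S k) := by
    rw [← differentiableOn_univ]
    exact (Complex.differentiableOn_dslope Filter.univ_mem).2
      (fun z _ => (hasDerivAt_sin_pi z).differentiableAt.differentiableWithinAt)
  have hSk : S k = 0 := by
    simp only [hS]; rw [mul_comm]; exact Complex.sin_int_mul_pi k
  have hSne : ∀ z : ℂ, z.re ∈ Set.Icc ((k : ℝ) - 1 / 2) ((k + 1 : ℤ) - 1 / 2) →
      dslope S k z ≠ 0 := by
    intro z hz
    by_cases hzk : z = k
    · rw [hzk, dslope_same, (hasDerivAt_sin_pi _).deriv, mul_comm (Real.pi : ℂ) (k : ℂ)]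
      have hc := Complex.cos_sq_add_sin_sq (k * Real.pi)
      rw [Complex.sin_int_mul_pi] at hc
      intro h0
      rcases mul_eq_zero.1 h0 with h | h
      · exact Real.pi_ne_zero (by exact_mod_cast h)
      · rw [h] at hc; norm_num at hc
    · rw [dslope_of_ne _ hzk, slope_def_field, hSk, sub_zero]
      refine div_ne_zero ?_ (sub_ne_zero.2 hzk)
      intro h0
      obtain ⟨m, hm⟩ := Complex.sin_eq_zero_iff.1 h0
      have hpi : (Real.pi : ℂ) ≠ 0 := by exact_mod_cast Real.pi_ne_zero
      have hzm : z = m := by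
        apply mul_left_cancel₀ hpi; rw [hm]; ring
      subst hzm
      simp only [intCast_re, Int.cast_add, Int.cast_one, Set.mem_Icc] at hz
      apply hzk
      have h1 : ((m : ℝ)) < k + 1 := by linarith [hz.2]
      have h2 : (k : ℝ) < m + 1 := by linarith [hz.1]
      have : m = k := by
        have h1' : m < k + 1 := by exact_mod_cast h1
        have h2' : k < m + 1 := by exact_mod_cast h2
        omega
      rw [this]
  have hz0 := rectIntegral_of_differentiable (x₁ := (k : ℝ) - 1 / 2)
    (x₂ := ((k + 1 : ℤ) : ℝ) - 1 / 2) (Y := Y)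
    (f := fun z => dslope F k z * (Real.pi * cos (Real.pi * z) / dslope S k z))
    (by push_cast; linarith) hY.le (by
      intro z hz _
      exact (hdF z).mul ((((hasDerivAt_cos_pi z).differentiableAt).const_mul _).div (hdS z)
        (hSne z hz)))
  have hEq : rectIntegral (fun z => F z * piCot z) (k - 1 / 2) ((k + 1 : ℤ) - 1 / 2) Y =
      rectIntegral (fun z => F k * piCot z +
        dslope F k z * (Real.pi * cos (Real.pi * z) / dslope S k z))
        (k - 1 / 2) ((k + 1 : ℤ) - 1 / 2) Y := by
    refine rectIntegral_congr hY.le fun z hz => ?_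
    have hs := sin_pi_ne_zero_of_mem hY hz
    have hzk : z ≠ k := by
      rintro rfl; exact hs hSk
    have e1 : (z - k) * dslope F k z = F z - F k := by
      simpa using sub_smul_dslope F (k : ℂ) z
    have e2 : (z - k) * dslope S k z = S z := by
      simpa [hSk] using sub_smul_dslope S (k : ℂ) z
    have hzk' := sub_ne_zero.2 hzk
    have e3 : dslope S k z = S z / (z - k) := by rw [← e2]; field_simp
    have e4 : F z = F k + (z - k) * dslope F k z := by rw [e1]; ring
    have hs' : S z ≠ 0 := hs
    change F z * (Real.pi * cos (Real.pi * z) / S z) = F k * (Real.pi * cos (Real.pi * z) / S z) + _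
    rw [e3, e4]
    field_simp
  have hsub : ∀ z ∈ rectBoundary ((k : ℝ) - 1 / 2) ((k + 1 : ℤ) - 1 / 2) Y,
      z.re ∈ Set.Icc ((k : ℝ) - 1 / 2) ((k + 1 : ℤ) - 1 / 2) := by
    intro z hz
    have hle : (k : ℝ) - 1 / 2 ≤ ((k + 1 : ℤ) : ℝ) - 1 / 2 := by push_cast; linarith
    rcases hz with h | h
    · have := h.1; rwa [Set.uIcc_of_le hle] at this
    · rcases h.1 with h | h <;> rw [h] <;> simp
  rw [hEq, rectIntegral_add hY.le ((continuousOn_piCot hY).const_mul _) ?_, hz0, add_zero,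
    rectIntegral_const_mul]
  · have := rectIntegral_piCot ((k : ℝ) - 1 / 2) hY
    rw [show ((k + 1 : ℤ) : ℝ) - 1 / 2 = (k : ℝ) - 1 / 2 + 1 by push_cast; ring, this]
    ring
  · intro z hz
    refine ContinuousAt.continuousWithinAt (DifferentiableAt.continuousAt (𝕜 := ℂ) ?_)
    exact (hdF z).mul ((((hasDerivAt_cos_pi z).differentiableAt).const_mul _).div (hdS z)
        (hSne z (hsub z hz)))

/-- The summation formula `∮ F(z) π cot(π z) dz = 2πi ∑ F(k)` on a rectangle. -/
lemma rectIntegral_mul_piCot (hF : Differentiable ℂ F) (A : ℤ) (N : ℕ) {Y : ℝ} (hY : 0 < Y) :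
    rectIntegral (fun z => F z * piCot z) (A - 1 / 2) ((A + N : ℤ) - 1 / 2) Y =
      2 * Real.pi * I * ∑ j ∈ Finset.range N, F ((A + j : ℤ) : ℂ) := by
  induction N with
  | zero => simp [rectIntegral]
  | succ N ih =>
    rw [Finset.sum_range_succ, mul_add, ← ih, ← rectIntegral_mul_piCot_cell hF (A + N : ℤ) hY]
    rw [show (A + (N + 1 : ℕ) : ℤ) = A + N + 1 by push_cast; ring]
    exact rectIntegral_adjacent hY.le (hF.continuous.continuousOn.mul (continuousOn_piCot hY))
      (hF.continuous.continuousOn.mul (continuousOn_piCot hY))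

lemma continuousOn_piCot' {A B : ℤ} {Y : ℝ} (hY : 0 < Y) :
    ContinuousOn piCot' (rectBoundary (A - 1 / 2) (B - 1 / 2) Y) := fun _ hz =>
  (hasDerivAt_piCot' (sin_pi_ne_zero_of_mem hY hz)).continuousAt.continuousWithinAt

lemma continuousOn_piCot'' {A B : ℤ} {Y : ℝ} (hY : 0 < Y) :
    ContinuousOn piCot'' (rectBoundary (A - 1 / 2) (B - 1 / 2) Y) := by
  unfold piCot''
  refine ContinuousOn.div (by fun_prop) (by fun_prop) fun z hz => ?_
  exact pow_ne_zero _ (sin_pi_ne_zero_of_mem hY hz)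

lemma rectIntegral_mul_piCot' (hF : Differentiable ℂ F) (A : ℤ) (N : ℕ) {Y : ℝ} (hY : 0 < Y) :
    2 * Real.pi * I * ∑ j ∈ Finset.range N, deriv F ((A + j : ℤ) : ℂ) =
      -rectIntegral (fun z => F z * piCot' z) (A - 1 / 2) ((A + N : ℤ) - 1 / 2) Y := by
  rw [← rectIntegral_mul_piCot hF.deriv A N hY, eq_neg_iff_add_eq_zero, ← rectIntegral_add hY.le]
  · refine rectIntegral_of_hasDerivAt (f := fun z => F z * piCot z) hY.le (fun z hz => ?_) ?_
    · exact (hF z).hasDerivAt.mul (hasDerivAt_piCot (sin_pi_ne_zero_of_mem hY hz))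
    · exact (hF.deriv.continuous.continuousOn.mul (continuousOn_piCot hY)).add
        (hF.continuous.continuousOn.mul (continuousOn_piCot' hY))
  · exact hF.deriv.continuous.continuousOn.mul (continuousOn_piCot hY)
  · exact hF.continuous.continuousOn.mul (continuousOn_piCot' hY)

lemma rectIntegral_mul_piCot'' (hF : Differentiable ℂ F) (A : ℤ) (N : ℕ) {Y : ℝ} (hY : 0 < Y) :
    2 * Real.pi * I * ∑ j ∈ Finset.range N, deriv (deriv F) ((A + j : ℤ) : ℂ) =
      rectIntegral (fun z => F z * piCot'' z) (A - 1 / 2) ((A + N : ℤ) - 1 / 2) Y := by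
  rw [rectIntegral_mul_piCot' hF.deriv A N hY, neg_eq_iff_add_eq_zero, ← rectIntegral_add hY.le]
  · refine rectIntegral_of_hasDerivAt (f := fun z => F z * piCot' z) hY.le (fun z hz => ?_) ?_
    · exact (hF z).hasDerivAt.mul (hasDerivAt_piCot' (sin_pi_ne_zero_of_mem hY hz))
    · exact (hF.deriv.continuous.continuousOn.mul (continuousOn_piCot' hY)).add
        (hF.continuous.continuousOn.mul (continuousOn_piCot'' hY))
  · exact hF.deriv.continuous.continuousOn.mul (continuousOn_piCot' hY)
  · exact hF.continuous.continuousOn.mul (continuousOn_piCot'' hY)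

lemma norm_le_of_two_pi_I_mul {S : ℂ} {B : ℝ} (h : ‖2 * Real.pi * I * S‖ ≤ B) : ‖S‖ ≤ B := by
  rw [norm_mul, norm_mul, norm_mul, norm_I, norm_real, Complex.norm_ofNat, Real.norm_eq_abs,
    abs_of_pos Real.pi_pos] at h
  nlinarith [norm_nonneg S, Real.pi_gt_three]

lemma half_int_or_one_le {A B : ℤ} {Y : ℝ} (hY : 1 ≤ Y) {z : ℂ}
    (hz : z ∈ rectBoundary (A - 1 / 2) (B - 1 / 2) Y) :
    1 ≤ |z.im| ∨ ∃ k : ℤ, z.re = k - 1 / 2 := by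
  rcases rectBoundary_half_int hz with h | h
  · left; rw [h]; exact hY
  · exact Or.inr h

lemma norm_sum_deriv_le (hF : Differentiable ℂ F) (A : ℤ) (N : ℕ) {Y B : ℝ} (hY : 1 ≤ Y)
    (hB : ∀ z ∈ rectBoundary (A - 1 / 2) ((A + N : ℤ) - 1 / 2) Y,
      ‖F z‖ * Real.exp (-(2 * Real.pi * |z.im|)) ≤ B) :
    ‖∑ j ∈ Finset.range N, deriv F ((A + j : ℤ) : ℂ)‖ ≤
      (2 * N + 4 * Y) * (16 * Real.pi ^ 2 * B) := by
  apply norm_le_of_two_pi_I_mul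
  rw [rectIntegral_mul_piCot' hF A N (by linarith), norm_neg]
  have := norm_rectIntegral_le (f := fun z => F z * piCot' z) (x₁ := (A : ℝ) - 1 / 2)
    (x₂ := ((A + N : ℤ) : ℝ) - 1 / 2) (Y := Y) (B := 16 * Real.pi ^ 2 * B)
    (by push_cast; linarith [(Nat.cast_nonneg N : (0 : ℝ) ≤ N)]) (by linarith) (by
      intro z hz
      rw [norm_mul]
      calc _ ≤ ‖F z‖ * (16 * Real.pi ^ 2 * Real.exp (-(2 * Real.pi * |z.im|))) := by
            gcongr; exact norm_piCot'_le (half_int_or_one_le hY hz)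
        _ = 16 * Real.pi ^ 2 * (‖F z‖ * Real.exp (-(2 * Real.pi * |z.im|))) := by ring
        _ ≤ _ := by gcongr; exact hB z hz)
  refine this.trans (le_of_eq ?_)
  push_cast; ring

lemma norm_sum_deriv_deriv_le (hF : Differentiable ℂ F) (A : ℤ) (N : ℕ) {Y B : ℝ} (hY : 1 ≤ Y)
    (hB : ∀ z ∈ rectBoundary (A - 1 / 2) ((A + N : ℤ) - 1 / 2) Y,
      ‖F z‖ * Real.exp (-(2 * Real.pi * |z.im|)) ≤ B) :
    ‖∑ j ∈ Finset.range N, deriv (deriv F) ((A + j : ℤ) : ℂ)‖ ≤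
      (2 * N + 4 * Y) * (128 * Real.pi ^ 3 * B) := by
  apply norm_le_of_two_pi_I_mul
  rw [rectIntegral_mul_piCot'' hF A N (by linarith)]
  have := norm_rectIntegral_le (f := fun z => F z * piCot'' z) (x₁ := (A : ℝ) - 1 / 2)
    (x₂ := ((A + N : ℤ) : ℝ) - 1 / 2) (Y := Y) (B := 128 * Real.pi ^ 3 * B)
    (by push_cast; linarith [(Nat.cast_nonneg N : (0 : ℝ) ≤ N)]) (by linarith) (by
      intro z hz
      rw [norm_mul]
      calc _ ≤ ‖F z‖ * (128 * Real.pi ^ 3 * Real.exp (-(2 * Real.pi * |z.im|))) := by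
            gcongr; exact norm_piCot''_le (half_int_or_one_le hY hz)
        _ = 128 * Real.pi ^ 3 * (‖F z‖ * Real.exp (-(2 * Real.pi * |z.im|))) := by ring
        _ ≤ _ := by gcongr; exact hB z hz)
  refine this.trans (le_of_eq ?_)
  push_cast; ring

end cot

section gamma

open Complex Filter Topology

lemma norm_add_I_mul (v y : ℝ) : ‖(v + y * I : ℂ)‖ = √(v ^ 2 + y ^ 2) := by
  rw [Complex.norm_add_mul_I]

lemma norm_GammaSeq {v : ℝ} (y : ℝ) {n : ℕ} (hn : n ≠ 0) :
    ‖GammaSeq (v + y * I) n‖ =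
      (n : ℝ) ^ v * n.factorial / ∏ j ∈ Finset.range (n + 1), √((v + j) ^ 2 + y ^ 2) := by
  have hn' : 0 < n := Nat.pos_of_ne_zero hn
  rw [GammaSeq, norm_div, norm_mul, Complex.norm_natCast_cpow_of_pos hn', norm_prod]
  simp only [add_re, ofReal_re, mul_re, I_re, mul_zero, ofReal_im, I_im, mul_one, sub_self,
    add_zero, Complex.norm_natCast]
  congr 1
  refine Finset.prod_congr rfl fun j _ => ?_
  rw [← norm_add_I_mul]; push_cast; ring_nf

/-- The ratio `‖Γ(v + iy)‖ / Γ(v)` is nondecreasing in `v`. -/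
lemma norm_Gamma_ratio_mono {v v' : ℝ} (hv : 0 < v) (h : v ≤ v') (y : ℝ) :
    ‖Gamma (v + y * I)‖ * Real.Gamma v' ≤ ‖Gamma (v' + y * I)‖ * Real.Gamma v := by
  refine le_of_tendsto_of_tendsto ((GammaSeq_tendsto_Gamma _).norm.mul
    (Real.GammaSeq_tendsto_Gamma v')) ((GammaSeq_tendsto_Gamma _).norm.mul
    (Real.GammaSeq_tendsto_Gamma v)) ?_
  filter_upwards [eventually_ne_atTop 0] with n hn
  rw [norm_GammaSeq y hn, norm_GammaSeq y hn, Real.GammaSeq, Real.GammaSeq]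
  have hpos : ∀ p : ℝ, 0 < p → 0 < ∏ j ∈ Finset.range (n + 1), √((p + j) ^ 2 + y ^ 2) :=
    fun p hp => Finset.prod_pos fun j _ => by positivity
  have hpos' : ∀ p : ℝ, 0 < p → 0 < ∏ j ∈ Finset.range (n + 1), (p + j) :=
    fun p hp => Finset.prod_pos fun j _ => by positivity
  have hv' : 0 < v' := hv.trans_le h
  have key : (∏ j ∈ Finset.range (n + 1), √((v' + j) ^ 2 + y ^ 2)) *
      ∏ j ∈ Finset.range (n + 1), (v + j) ≤
      (∏ j ∈ Finset.range (n + 1), √((v + j) ^ 2 + y ^ 2)) *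
      ∏ j ∈ Finset.range (n + 1), (v' + j) := by
    rw [← Finset.prod_mul_distrib, ← Finset.prod_mul_distrib]
    refine Finset.prod_le_prod (fun j _ => by positivity) fun j _ => ?_
    have h1 : 0 < v + j := by positivity
    have h2 : v + j ≤ v' + j := by linarith
    rw [← sq_le_sq₀ (by positivity) (by positivity), mul_pow, mul_pow,
      Real.sq_sqrt (by positivity), Real.sq_sqrt (by positivity)]
    have : (v + j) ^ 2 ≤ (v' + j) ^ 2 := by gcongr
    nlinarith [sq_nonneg y]
  have a1 := hpos v hv
  have a2 := hpos v' hv'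
  have a3 := hpos' v hv
  have a4 := hpos' v' hv'
  rw [div_mul_div_comm, div_mul_div_comm, div_le_div_iff₀ (by positivity) (by positivity)]
  have : (0 : ℝ) ≤ (n : ℝ) ^ v * n.factorial * ((n : ℝ) ^ v' * n.factorial) := by positivity
  nlinarith [mul_le_mul_of_nonneg_left key this]

lemma Gamma_le_norm_Gamma_mul_exp {v : ℝ} (hv : 1 < v) (y : ℝ) :
    Real.Gamma v ≤ ‖Gamma (v + y * I)‖ * Real.exp (y ^ 2 / (2 * (v - 1))) := by
  refine le_of_tendsto_of_tendsto (Real.GammaSeq_tendsto_Gamma v)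
    ((GammaSeq_tendsto_Gamma _).norm.mul_const _) ?_
  filter_upwards [eventually_ne_atTop 0] with n hn
  rw [norm_GammaSeq y hn, Real.GammaSeq]
  have key : ∏ j ∈ Finset.range (n + 1), √((v + j) ^ 2 + y ^ 2) ≤
      (∏ j ∈ Finset.range (n + 1), (v + j)) * Real.exp (y ^ 2 / (2 * (v - 1))) := by
    have tele : ∑ j ∈ Finset.range (n + 1), y ^ 2 / 2 * (1 / (v + j - 1) - 1 / (v + (j + 1 : ℕ) - 1))
        ≤ y ^ 2 / (2 * (v - 1)) := by
      rw [← Finset.mul_sum, Finset.sum_range_sub' (fun j : ℕ => 1 / (v + j - 1))]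
      have h1 : 0 ≤ 1 / (v + (n + 1 : ℕ) - 1) := by
        push_cast
        have : 0 < v + (n + 1) - 1 := by
          have : (0 : ℝ) ≤ n := Nat.cast_nonneg n
          linarith
        positivity
      have h2 : y ^ 2 / (2 * (v - 1)) = y ^ 2 / 2 * (1 / (v + (0 : ℕ) - 1)) := by
        have : v - 1 ≠ 0 := by linarith
        simp; field_simp
      rw [h2]
      gcongr
      linarith
    refine le_trans ?_ (mul_le_mul_of_nonneg_left (Real.exp_le_exp.2 tele)
      (Finset.prod_nonneg fun j _ => by positivity))
    rw [Real.exp_sum, ← Finset.prod_mul_distrib]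
    refine Finset.prod_le_prod (fun j _ => by positivity) fun j _ => ?_
    have hj : (0 : ℝ) ≤ j := Nat.cast_nonneg j
    set p : ℝ := v + j with hp
    have hp1 : 1 < p := by linarith
    rw [show v + ((j + 1 : ℕ) : ℝ) - 1 = p by push_cast; rw [hp]; ring]
    rw [Real.sqrt_le_left (by positivity), mul_pow, ← Real.exp_nat_mul]
    have h1 : (y / p) ^ 2 ≤ (2 : ℕ) * (y ^ 2 / 2 * (1 / (p - 1) - 1 / p)) := by
      have : p - 1 > 0 := by linarith
      have e : ((2 : ℕ) : ℝ) * (y ^ 2 / 2 * (1 / (p - 1) - 1 / p)) = y ^ 2 / ((p - 1) * p) := by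
        field_simp; push_cast; ring
      rw [e, div_pow]
      gcongr
      nlinarith
    calc p ^ 2 + y ^ 2 = p ^ 2 * ((y / p) ^ 2 + 1) := by field_simp; ring
      _ ≤ _ := by
        gcongr
        exact (add_le_add_left h1 1).trans (Real.add_one_le_exp _)
  have a1 : 0 < ∏ j ∈ Finset.range (n + 1), √((v + j) ^ 2 + y ^ 2) :=
    Finset.prod_pos fun j _ => by positivity
  have a2 : 0 < ∏ j ∈ Finset.range (n + 1), (v + j) :=
    Finset.prod_pos fun j _ => by positivity
  rw [div_mul_eq_mul_div, div_le_div_iff₀ a2 a1]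
  have : (0 : ℝ) ≤ (n : ℝ) ^ v * n.factorial := by positivity
  nlinarith [mul_le_mul_of_nonneg_left key this]

lemma norm_Gamma_conj (v y : ℝ) : ‖Gamma (v - y * I)‖ = ‖Gamma (v + y * I)‖ := by
  have : (v - y * I : ℂ) = (starRingEnd ℂ) (v + y * I) := by simp [sub_eq_add_neg]
  rw [this, Gamma_conj, RCLike.norm_conj]

lemma exp_le_norm_Gamma_one_add {y : ℝ} (hy : 1 ≤ y) :
    Real.exp (-(Real.pi * y / 2)) ≤ ‖Gamma (1 + y * I)‖ := by
  have hy0 : (y * I : ℂ) ≠ 0 := mul_ne_zero (by exact_mod_cast (by linarith : y ≠ 0)) I_ne_zero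
  have h := Gamma_mul_Gamma_one_sub (y * I)
  have h1 : Gamma (1 + y * I) * Gamma (1 - y * I) =
      y * I * (Real.pi / sin (Real.pi * (y * I))) := by
    rw [← h, add_comm, Gamma_add_one _ hy0]; ring
  have h2 := congrArg norm h1
  have hc := norm_Gamma_conj 1 y
  rw [ofReal_one] at hc
  rw [norm_mul, hc, norm_mul, norm_mul, norm_div, norm_I, norm_real, norm_real, Real.norm_eq_abs,
    Real.norm_eq_abs, abs_of_pos Real.pi_pos, abs_of_pos (by linarith), mul_one] at h2
  have h3 := norm_sin_pi_le (y * I)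
  have h3' : 0 < ‖sin (Real.pi * (y * I))‖ := norm_pos_iff.2
    (sin_pi_ne_zero (Or.inl (by simpa using (by linarith : y ≠ 0))))
  simp only [mul_im, ofReal_re, I_im, mul_one, ofReal_im, I_re, mul_zero, add_zero] at h3
  rw [abs_of_pos (by linarith)] at h3
  rw [← sq_le_sq₀ (Real.exp_nonneg _) (norm_nonneg _), sq ‖_‖, h2, ← Real.exp_nat_mul,
    show ((2 : ℕ) : ℝ) * -(Real.pi * y / 2) = -(Real.pi * y) by push_cast; ring, Real.exp_neg]
  calc (Real.exp (Real.pi * y))⁻¹ = 1 * (1 / Real.exp (Real.pi * y)) := by ring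
    _ ≤ y * (Real.pi / ‖sin (Real.pi * (y * I))‖) := by
      gcongr
      linarith [Real.pi_gt_three]

lemma exp_le_norm_Gamma_half_add (y : ℝ) :
    Real.exp (-(Real.pi * |y| / 2)) ≤ ‖Gamma (1 / 2 + y * I)‖ := by
  have h := Gamma_mul_Gamma_one_sub (1 / 2 + y * I)
  have h2 := congrArg norm h
  have hc := norm_Gamma_conj (1 / 2) y
  push_cast at hc
  rw [show (1 - (1 / 2 + y * I) : ℂ) = 1 / 2 - y * I by ring, norm_mul, hc, norm_div,
    norm_real, Real.norm_eq_abs, abs_of_pos Real.pi_pos] at h2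
  have h3 := norm_sin_pi_le (1 / 2 + y * I)
  have h3' : 0 < ‖sin (Real.pi * (1 / 2 + y * I))‖ := norm_pos_iff.2
    (sin_pi_ne_zero (Or.inr ⟨1, by norm_num⟩))
  have e : (1 / 2 + y * I : ℂ).im = y := by norm_num
  rw [e] at h3
  rw [← sq_le_sq₀ (Real.exp_nonneg _) (norm_nonneg _), sq ‖_‖, h2, ← Real.exp_nat_mul,
    show ((2 : ℕ) : ℝ) * -(Real.pi * |y| / 2) = -(Real.pi * |y|) by push_cast; ring, Real.exp_neg,
    ← one_div]
  gcongr
  linarith [Real.pi_gt_three]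

lemma norm_Gamma_nat_add (m : ℕ) {y : ℝ} (hy : y ≠ 0) :
    ‖Gamma ((m : ℝ) + 1 + y * I)‖ =
      ‖Gamma (1 + y * I)‖ * ∏ j ∈ Finset.range m, √(((j : ℝ) + 1) ^ 2 + y ^ 2) := by
  induction m with
  | zero => simp
  | succ m ih =>
    rw [Finset.prod_range_succ, ← mul_assoc, ← ih]
    have e : (((m + 1 : ℕ) : ℝ) + 1 + y * I : ℂ) = (((m : ℝ) + 1 + y * I : ℂ)) + 1 := by
      push_cast; ring
    have hne : ((m : ℝ) + 1 + y * I : ℂ) ≠ 0 := by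
      intro h0
      apply hy
      simpa using congrArg im h0
    rw [e, Gamma_add_one _ hne, norm_mul, mul_comm]
    congr 1
    have := norm_add_I_mul ((m : ℝ) + 1) y
    push_cast at this ⊢
    exact this

/-- Lower bound for `Γ` in the right half plane. -/
lemma prod_le_norm_Gamma {u y : ℝ} (hu : 0 ≤ u) (hy : 1 ≤ y) :
    Real.exp (-(Real.pi * y / 2)) / 2 * ∏ j ∈ Finset.range ⌊u⌋₊, √(((j : ℝ) + 1) ^ 2 + y ^ 2) ≤
      ‖Gamma (u + 1 + y * I)‖ := by
  set m := ⌊u⌋₊ with hm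
  have hmu : (m : ℝ) ≤ u := Nat.floor_le hu
  have h1 := norm_Gamma_ratio_mono (v := (m : ℝ) + 1) (v' := u + 1) (by positivity)
    (by linarith) y
  have h2 : Real.Gamma ((m : ℝ) + 1) ≤ 2 * Real.Gamma (u + 1) := by
    rcases Nat.eq_zero_or_pos m with h | h
    · rw [h]
      simp only [Nat.cast_zero, zero_add, Real.Gamma_one]
      have hu1 : u < 1 := by
        have := Nat.lt_floor_add_one u
        rw [← hm, h] at this
        simpa using this
      have h3 := Real.Gamma_strictMonoOn_Ici.monotoneOn (a := 2) (b := u + 1 + 1) (by simp)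
        (by simp; linarith) (by linarith)
      rw [Real.Gamma_two, Real.Gamma_add_one (by linarith)] at h3
      have := Real.Gamma_pos_of_pos (s := u + 1) (by linarith)
      nlinarith
    · have h' : (1 : ℝ) ≤ m := by exact_mod_cast h
      have h3 := Real.Gamma_strictMonoOn_Ici.monotoneOn (a := (m : ℝ) + 1) (b := u + 1)
        (by simp; linarith) (by simp; linarith) (by linarith)
      have := Real.Gamma_pos_of_pos (s := u + 1) (by linarith)
      linarith
  have h0 : 0 < Real.Gamma ((m : ℝ) + 1) := Real.Gamma_pos_of_pos (by positivity)
  have h3 := norm_Gamma_nat_add m (y := y) (by linarith)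
  have h4 := exp_le_norm_Gamma_one_add hy
  push_cast at h1
  rw [show ((m : ℂ)) = ((m : ℝ) : ℂ) by push_cast; rfl, h3] at h1
  set P := ∏ j ∈ Finset.range m, √(((j : ℝ) + 1) ^ 2 + y ^ 2)
  have hP : 0 ≤ P := Finset.prod_nonneg fun j _ => by positivity
  have h5 : Real.exp (-(Real.pi * y / 2)) * P ≤ ‖Gamma (1 + y * I)‖ * P := by gcongr
  have h6 : ‖Gamma (1 + y * I)‖ * P * Real.Gamma ((m : ℝ) + 1) ≤
      ‖Gamma (1 + y * I)‖ * P * (2 * Real.Gamma (u + 1)) := by gcongr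
  have h7 : ‖Gamma (1 + y * I)‖ * P ≤ 2 * ‖Gamma (u + 1 + y * I)‖ := by
    have : ‖Gamma (1 + y * I)‖ * P * Real.Gamma ((m : ℝ) + 1) ≤
        2 * ‖Gamma (u + 1 + y * I)‖ * Real.Gamma ((m : ℝ) + 1) := by nlinarith
    exact le_of_mul_le_mul_right this h0
  linarith

end gamma

section tangent

variable {x y : ℝ}

/-- The convex primitive `D` of `v ↦ log (√(v² + y²) / x)` with `D 0 = 0`. -/
noncomputable def logPrimitive (x y v : ℝ) : ℝ :=
  1 / 2 * v * Real.log (v ^ 2 + y ^ 2) - v + y * Real.arctan (v / y) - v * Real.log x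

lemma hasDerivAt_logPrimitive (hy : 0 < y) (v : ℝ) :
    HasDerivAt (logPrimitive x y) (1 / 2 * Real.log (v ^ 2 + y ^ 2) - Real.log x) v := by
  have h1 : HasDerivAt (fun v : ℝ => v ^ 2 + y ^ 2) (2 * v) v := by
    simpa using (hasDerivAt_pow 2 v).add_const (y ^ 2)
  have h2 := ((hasDerivAt_id v).const_mul (1 / 2 : ℝ)).mul (h1.log (by positivity))
  have h3 := ((hasDerivAt_id v).div_const y).arctan.const_mul y
  have h4 := ((h2.sub (hasDerivAt_id v)).add h3).sub ((hasDerivAt_id v).mul_const (Real.log x))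
  convert! h4 using 1
  simp only [id_eq]
  have h5 : v ^ 2 + y ^ 2 ≠ 0 := by positivity
  have h6 : (1 : ℝ) + (v / y) ^ 2 = (v ^ 2 + y ^ 2) / y ^ 2 := by field_simp; ring
  rw [h6]
  field_simp
  ring

lemma logPrimitive_tangent (hy : 0 < y) {v w : ℝ} (hv : 0 ≤ v) (hw : 0 ≤ w) :
    (1 / 2 * Real.log (v ^ 2 + y ^ 2) - Real.log x) * (w - v) ≤
      logPrimitive x y w - logPrimitive x y v := by
  have hcont : Continuous (logPrimitive x y) :=
    continuous_iff_continuousAt.2 fun v => (hasDerivAt_logPrimitive hy v).continuousAt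
  rcases lt_trichotomy v w with h | h | h
  · obtain ⟨c, hc, he⟩ := exists_hasDerivAt_eq_slope (logPrimitive x y) _ h hcont.continuousOn
      fun c _ => hasDerivAt_logPrimitive hy c
    rw [eq_div_iff (by linarith)] at he
    rw [← he]
    have : Real.log (v ^ 2 + y ^ 2) ≤ Real.log (c ^ 2 + y ^ 2) := by
      apply Real.log_le_log (by positivity); nlinarith [hc.1]
    nlinarith
  · simp [h]
  · obtain ⟨c, hc, he⟩ := exists_hasDerivAt_eq_slope (logPrimitive x y) _ h hcont.continuousOn
      fun c _ => hasDerivAt_logPrimitive hy c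
    rw [eq_div_iff (by linarith)] at he
    have : Real.log (c ^ 2 + y ^ 2) ≤ Real.log (v ^ 2 + y ^ 2) := by
      apply Real.log_le_log (by nlinarith [hc.1, sq_nonneg c, sq_nonneg y, pow_pos hy 2])
      nlinarith [hc.1, hc.2]
    nlinarith

lemma exp_le_prod_sqrt (hx : 0 < x) {θ : ℝ} (h0 : 0 < θ) (h1 : θ ≤ Real.pi / 2) (m : ℕ) :
    Real.exp (x * Real.sin θ * (Real.pi / 2 - θ) - x * Real.cos θ) ≤
      ∏ j ∈ Finset.range m, (√(((j : ℝ) + 1) ^ 2 + (x * Real.sin θ) ^ 2) / x) := by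
  have hs : 0 < Real.sin θ := Real.sin_pos_of_pos_of_lt_pi h0 (by linarith [Real.pi_pos])
  have hc : 0 ≤ Real.cos θ := Real.cos_nonneg_of_mem_Icc ⟨by linarith [Real.pi_pos], h1⟩
  set y := x * Real.sin θ with hyd
  have hy : 0 < y := by positivity
  have step : ∀ m : ℕ, Real.exp (logPrimitive x y m) ≤
      ∏ j ∈ Finset.range m, (√(((j : ℝ) + 1) ^ 2 + y ^ 2) / x) := by
    intro m
    induction m with
    | zero => simp [logPrimitive]
    | succ m ih =>
      rw [Finset.prod_range_succ]
      have ht := logPrimitive_tangent (x := x) hy (v := (m : ℝ) + 1) (w := m) (by positivity)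
        (by positivity)
      have hl : √(((m : ℝ) + 1) ^ 2 + y ^ 2) / x =
          Real.exp (1 / 2 * Real.log (((m : ℝ) + 1) ^ 2 + y ^ 2) - Real.log x) := by
        rw [Real.exp_sub, Real.exp_log hx, Real.sqrt_eq_rpow, Real.rpow_def_of_pos (by positivity),
          mul_comm (1 / 2 : ℝ)]
      rw [hl]
      calc _ ≤ Real.exp (logPrimitive x y m) *
            Real.exp (1 / 2 * Real.log (((m : ℝ) + 1) ^ 2 + y ^ 2) - Real.log x) := by
            rw [← Real.exp_add]
            apply Real.exp_le_exp.2
            push_cast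
            linarith
        _ ≤ _ := by gcongr
  refine le_trans (Real.exp_le_exp.2 ?_) (step m)
  have ht := logPrimitive_tangent (x := x) hy (v := x * Real.cos θ) (w := m) (by positivity)
    (by positivity)
  have e1 : (x * Real.cos θ) ^ 2 + y ^ 2 = x ^ 2 := by
    rw [hyd]; linear_combination x ^ 2 * Real.sin_sq_add_cos_sq θ
  have e2 : Real.log (x ^ 2) = 2 * Real.log x := by rw [Real.log_pow]; norm_num
  have e3 : Real.arctan (x * Real.cos θ / y) = Real.pi / 2 - θ := by
    have : x * Real.cos θ / y = Real.tan (Real.pi / 2 - θ) := by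
      rw [Real.tan_eq_sin_div_cos, Real.sin_pi_div_two_sub, Real.cos_pi_div_two_sub, hyd]
      field_simp
    rw [this, Real.arctan_tan (by linarith) (by linarith)]
  rw [e1, e2] at ht
  have e4 : logPrimitive x y (x * Real.cos θ) = y * (Real.pi / 2 - θ) - x * Real.cos θ := by
    rw [logPrimitive, e1, e2, e3]; ring
  rw [e4] at ht
  linarith

end tangent

section jet

open Complex

/-- `f` is entire, with value `v`, logarithmic derivative `l` and second logarithmic derivative `m`
at `z`; this is phrased without division, so that it makes sense for `v = 0` as well. -/
structure Jet (f : ℂ → ℂ) (z v l m : ℂ) : Prop where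
  differentiable : Differentiable ℂ f
  val : f z = v
  fst : deriv f z = v * l
  snd : deriv (deriv f) z = v * (l ^ 2 + m)

lemma differentiable_deriv_complex {f : ℂ → ℂ} (hf : Differentiable ℂ f) :
    Differentiable ℂ (deriv f) :=
  (hf.contDiff (n := 2)).differentiable_deriv_two

lemma deriv_mul_eq {f g : ℂ → ℂ} (hf : Differentiable ℂ f) (hg : Differentiable ℂ g) :
    deriv (fun s ↦ f s * g s) = fun s ↦ deriv f s * g s + f s * deriv g s :=
  funext fun s ↦ deriv_fun_mul (hf s) (hg s)

lemma deriv_deriv_mul_eq {f g : ℂ → ℂ} (hf : Differentiable ℂ f) (hg : Differentiable ℂ g) :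
    deriv (deriv (fun s ↦ f s * g s)) = fun s ↦ deriv (deriv f) s * g s +
      2 * (deriv f s * deriv g s) + f s * deriv (deriv g) s := by
  rw [deriv_mul_eq hf hg]
  funext s
  rw [deriv_fun_add ((differentiable_deriv_complex hf s).fun_mul (hg s))
      ((hf s).fun_mul (differentiable_deriv_complex hg s)),
    deriv_fun_mul (differentiable_deriv_complex hf s) (hg s), deriv_fun_mul (hf s) (differentiable_deriv_complex hg s)]
  ring

namespace Jet

variable {f g : ℂ → ℂ} {z v l m v' l' m' : ℂ}

lemma const (c z : ℂ) : Jet (fun _ ↦ c) z c 0 0 :=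
  ⟨differentiable_const c, rfl, by simp, by simp⟩

lemma mul (hf : Jet f z v l m) (hg : Jet g z v' l' m') :
    Jet (fun s ↦ f s * g s) z (v * v') (l + l') (m + m') where
  differentiable := hf.differentiable.mul hg.differentiable
  val := by rw [hf.val, hg.val]
  fst := by
    rw [deriv_mul_eq hf.differentiable hg.differentiable]
    simp only [hf.val, hg.val, hf.fst, hg.fst]
    ring
  snd := by
    rw [deriv_deriv_mul_eq hf.differentiable hg.differentiable]
    simp only [hf.val, hg.val, hf.fst, hg.fst, hf.snd, hg.snd]
    ring

lemma pow (hf : Jet f z v l m) (k : ℕ) :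
    Jet (fun s ↦ f s ^ k) z (v ^ k) (k * l) (k * m) := by
  induction k with
  | zero => simpa using const 1 z
  | succ k ih =>
    have h := ih.mul hf
    simp only [pow_succ]
    convert h using 1 <;> push_cast <;> ring

lemma comp_const_sub (c : ℂ) (hf : Jet f (c - z) v l m) :
    Jet (fun s ↦ f (c - s)) z v (-l) m := by
  have key : ∀ h : ℂ → ℂ, deriv (fun s ↦ h (c - s)) = fun s ↦ -deriv h (c - s) :=
    fun h ↦ funext fun s ↦ deriv_comp_const_sub h c s
  refine ⟨hf.differentiable.comp ((differentiable_const c).sub differentiable_id), hf.val, ?_, ?_⟩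
  · rw [key]
    simp only [hf.fst]
    ring
  · rw [key f, deriv.fun_neg', key]
    simp only [hf.snd]
    ring

end Jet

/-- The entire function `1 / Γ(s + 1)`. -/
noncomputable def invFactorial (s : ℂ) : ℂ := (Gamma (s + 1))⁻¹

lemma differentiable_invFactorial : Differentiable ℂ invFactorial :=
  differentiable_one_div_Gamma.comp (differentiable_id.add_const 1)

lemma invFactorial_natCast (k : ℕ) : invFactorial k = (k.factorial : ℂ)⁻¹ := by
  rw [invFactorial, Gamma_nat_eq_factorial]

lemma invFactorial_neg_natCast (k : ℕ) : invFactorial (-((k + 1 : ℕ) : ℂ)) = 0 := by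
  have h : (-((k + 1 : ℕ) : ℂ)) + 1 = -(k : ℂ) := by push_cast; ring
  rw [invFactorial, h, Gamma_neg_nat_eq_zero, inv_zero]

lemma invFactorial_sub_one (s : ℂ) : invFactorial (s - 1) = s * invFactorial s := by
  rw [invFactorial, invFactorial, sub_add_cancel, one_div_Gamma_eq_self_mul_one_div_Gamma_add_one]

lemma pi_mul_invFactorial_mul_neg (s : ℂ) :
    s * (invFactorial s * invFactorial (0 - s)) = sin (Real.pi * s) / Real.pi := by
  rw [← mul_assoc, ← invFactorial_sub_one, invFactorial, invFactorial, sub_add_cancel,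
    zero_sub, neg_add_eq_sub, ← mul_inv, Gamma_mul_Gamma_one_sub, inv_div]

lemma deriv_invFactorial_zero :
    deriv invFactorial 0 = (Real.eulerMascheroniConstant : ℂ) := by
  have h : HasDerivAt (fun s : ℂ ↦ Gamma (s + 1)) (-(Real.eulerMascheroniConstant : ℂ)) 0 := by
    refine HasDerivAt.comp_add_const 0 1 ?_
    simpa using hasDerivAt_Gamma_one
  have h2 := h.inv (by simp)
  rw [show invFactorial = fun s ↦ (Gamma (s + 1))⁻¹ from rfl]
  simpa [Pi.inv_def] using h2.deriv

lemma deriv_deriv_invFactorial_zero :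
    deriv (deriv invFactorial) 0 =
      (Real.eulerMascheroniConstant : ℂ) ^ 2 - (Real.pi : ℂ) ^ 2 / 6 := by
  set γ : ℂ := (Real.eulerMascheroniConstant : ℂ)
  have hd := differentiable_invFactorial
  have h0 : invFactorial 0 = 1 := by simp [invFactorial]
  have J : Jet invFactorial 0 1 γ (deriv (deriv invFactorial) 0 - γ ^ 2) :=
    ⟨hd, h0, by rw [deriv_invFactorial_zero, one_mul], by ring⟩
  have J' := J.mul (Jet.comp_const_sub (z := 0) 0 (by simpa using J))
  set h : ℂ → ℂ := fun s ↦ invFactorial s * invFactorial (0 - s)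
  have hh : Differentiable ℂ h := J'.differentiable
  have e : (fun s ↦ s * h s) = fun s ↦ sin (Real.pi * s) / Real.pi :=
    funext pi_mul_invFactorial_mul_neg
  have hpi : (Real.pi : ℂ) ≠ 0 := by exact_mod_cast Real.pi_ne_zero
  have e2 : deriv (deriv (fun s ↦ s * h s)) = fun s ↦ 2 * deriv h s + s * deriv (deriv h) s := by
    rw [deriv_deriv_mul_eq differentiable_fun_id hh]
    simp
  have e3 : deriv (deriv (fun s : ℂ ↦ sin (Real.pi * s) / Real.pi)) =
      fun s ↦ -(sin (Real.pi * s) * Real.pi) := by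
    have a1 : deriv (fun s : ℂ ↦ sin (Real.pi * s) / Real.pi) = fun s ↦ cos (Real.pi * s) :=
      funext fun s ↦ by
        rw [((hasDerivAt_sin_pi s).div_const _).deriv]
        field_simp
    rw [a1]
    funext s
    rw [(hasDerivAt_cos_pi s).deriv]
    ring
  have e4 := congrArg (fun f ↦ deriv f 0)
    (e2.symm.trans ((congrArg (fun f ↦ deriv (deriv f)) e).trans e3))
  have hd1 := differentiable_deriv_complex hh
  have hd2 := differentiable_deriv_complex hd1
  rw [deriv_fun_add ((hd1 0).const_mul 2) (differentiableAt_fun_id.fun_mul (hd2 0)),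
    deriv_fun_mul differentiableAt_fun_id (hd2 0),
    ((hasDerivAt_sin_pi 0).mul_const _).fun_neg.deriv,
    deriv_const_mul _ (hd1 0), J'.snd] at e4
  simp at e4
  linear_combination e4 / 6

lemma jet_invFactorial (k : ℕ) :
    Jet invFactorial k (k.factorial : ℂ)⁻¹ (Real.eulerMascheroniConstant - harmonic k)
      (genHarmonic 2 k - (Real.pi : ℂ) ^ 2 / 6) := by
  have hd := differentiable_invFactorial
  induction k with
  | zero =>
    refine ⟨hd, invFactorial_natCast 0, ?_, ?_⟩
    · simpa using deriv_invFactorial_zero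
    · simp [genHarmonic, deriv_deriv_invFactorial_zero]
      ring
  | succ k ih =>
    have e : (fun s ↦ invFactorial (s - 1)) = fun s ↦ s * invFactorial s :=
      funext invFactorial_sub_one
    have key : ∀ h : ℂ → ℂ, deriv (fun s ↦ h (s - 1)) = fun s ↦ deriv h (s - 1) :=
      fun h ↦ funext fun s ↦ deriv_comp_sub_const h 1 s
    have hk : ((k : ℂ) + 1) ≠ 0 := by exact_mod_cast k.succ_ne_zero
    have hf : (k.factorial : ℂ) ≠ 0 := by exact_mod_cast k.factorial_ne_zero
    have e1 := congrArg (fun f ↦ deriv f ((k + 1 : ℕ) : ℂ)) e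
    have e2 := congrArg (fun f ↦ deriv (deriv f) ((k + 1 : ℕ) : ℂ)) e
    rw [deriv_mul_eq differentiable_fun_id hd, key] at e1
    rw [deriv_deriv_mul_eq differentiable_fun_id hd, key, key] at e2
    simp [ih.fst] at e1
    simp [ih.snd] at e2
    have d1 : deriv invFactorial ((k : ℂ) + 1) = ((k + 1).factorial : ℂ)⁻¹ *
        (Real.eulerMascheroniConstant - harmonic (k + 1)) := by
      have hv := invFactorial_natCast (k + 1)
      push_cast [Nat.factorial_succ] at hv ⊢
      rw [hv] at e1
      rw [harmonic_succ]
      push_cast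
      field_simp at e1 ⊢
      linear_combination -e1
    refine ⟨hd, invFactorial_natCast _, ?_, ?_⟩
    · rw [← d1]; push_cast; rfl
    · rw [d1] at e2
      rw [harmonic_succ] at *
      simp only [genHarmonic] at *
      rw [Finset.sum_range_succ]
      push_cast [Nat.factorial_succ] at e2 ⊢
      field_simp at e2 ⊢
      linear_combination -e2

/-- The entire function of `s` interpolating `C(n, s) ^ a * (n - s)!`. -/
noncomputable def weight (a n : ℕ) (s : ℂ) : ℂ :=
  (n.factorial : ℂ) ^ a * (invFactorial (n - s) ^ (a - 1) * invFactorial s ^ a)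

lemma differentiable_weight (a n : ℕ) : Differentiable ℂ (weight a n) :=
  (((differentiable_invFactorial.comp ((differentiable_const _).sub differentiable_id)).pow _).mul
    (differentiable_invFactorial.pow _)).const_mul _

lemma jet_weight {a n k : ℕ} (ha : 1 ≤ a) (hk : k ≤ n) :
    Jet (weight a n) k ((n.choose k : ℂ) ^ a * (n - k).factorial)
      (Real.eulerMascheroniConstant - r1 a n (n - k))
      (r2 a n (n - k) - (2 * a - 1) * (Real.pi : ℂ) ^ 2 / 6) := by
  have h1 := jet_invFactorial (n - k)
  rw [Nat.cast_sub hk] at h1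
  have h : Jet (weight a n) k _ _ _ := (Jet.const ((n.factorial : ℂ) ^ a) k).mul
    (((Jet.comp_const_sub (n : ℂ) h1).pow (a - 1)).mul ((jet_invFactorial k).pow a))
  have hf : (k.factorial : ℂ) ≠ 0 := by exact_mod_cast k.factorial_ne_zero
  have hf' : ((n - k).factorial : ℂ) ≠ 0 := by exact_mod_cast (n - k).factorial_ne_zero
  obtain ⟨b, rfl⟩ := Nat.exists_eq_add_of_le' ha
  convert h using 1
  · rw [Nat.cast_choose ℂ hk, Nat.add_sub_cancel, div_pow, mul_pow, inv_pow, inv_pow,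
      pow_succ (((n - k).factorial : ℂ))]
    field_simp
  · rw [r1, Nat.sub_sub_self hk]
    push_cast [Nat.add_sub_cancel]
    ring
  · rw [r2, Nat.sub_sub_self hk]
    push_cast [Nat.add_sub_cancel]
    ring

lemma deriv_sq_mul_eq_zero {h S : ℂ → ℂ} {z : ℂ} (hh : Differentiable ℂ h)
    (hS : Differentiable ℂ S) (hz : h z = 0) : deriv (fun s ↦ h s ^ 2 * S s) z = 0 := by
  rw [deriv_fun_mul ((hh z).fun_pow 2) (hS z), deriv_fun_pow (hh z)]
  simp [hz]

lemma deriv_cube_mul_eq_zero {h S : ℂ → ℂ} {z : ℂ} (hh : Differentiable ℂ h)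
    (hS : Differentiable ℂ S) (hz : h z = 0) :
    deriv (fun s ↦ h s ^ 3 * S s) z = 0 ∧ deriv (deriv (fun s ↦ h s ^ 3 * S s)) z = 0 := by
  constructor
  · simpa [pow_succ, mul_assoc] using deriv_sq_mul_eq_zero hh (hh.mul hS) hz
  · have e : deriv (fun s ↦ h s ^ 3 * S s) =
        fun s ↦ h s ^ 2 * (3 * deriv h s * S s + h s * deriv S s) := by
      funext s
      rw [deriv_fun_mul ((hh s).fun_pow 3) (hS s), deriv_fun_pow (hh s)]
      push_cast
      ring
    have h1 := differentiable_deriv_complex hh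
    have h2 := differentiable_deriv_complex hS
    rw [e]
    exact deriv_sq_mul_eq_zero hh (((h1.const_mul 3).mul hS).add (hh.mul h2)) hz

lemma deriv_weight_neg {a : ℕ} (ha : 3 ≤ a) (n k : ℕ) :
    deriv (weight a n) (-((k + 1 : ℕ) : ℂ)) = 0 ∧
      deriv (deriv (weight a n)) (-((k + 1 : ℕ) : ℂ)) = 0 := by
  obtain ⟨b, rfl⟩ := Nat.exists_eq_add_of_le ha
  have e : weight (3 + b) n = fun s ↦ invFactorial s ^ 3 *
      ((n.factorial : ℂ) ^ (3 + b) * (invFactorial (n - s) ^ (3 + b - 1) * invFactorial s ^ b)) := by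
    funext s
    rw [weight, pow_add (invFactorial s)]
    ring
  rw [e]
  exact deriv_cube_mul_eq_zero differentiable_invFactorial
    ((((differentiable_invFactorial.comp ((differentiable_const _).sub differentiable_id)).pow _).mul
    (differentiable_invFactorial.pow _)).const_mul _) (invFactorial_neg_natCast k)

lemma sum_int_range_eq {f : ℂ → ℂ} (hf : ∀ k : ℕ, f (-((k + 1 : ℕ) : ℂ)) = 0) (M N : ℕ) :
    ∑ j ∈ Finset.range (M + N), f ((-(M : ℤ) + j : ℤ) : ℂ) = ∑ j ∈ Finset.range N, f j := by
  rw [Finset.sum_range_add]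
  rw [Finset.sum_eq_zero, zero_add]
  · refine Finset.sum_congr rfl fun j _ ↦ ?_
    congr 1
    push_cast
    ring
  · intro j hj
    rw [Finset.mem_range] at hj
    obtain ⟨k, rfl⟩ := Nat.exists_eq_add_of_lt hj
    rw [← hf k]
    congr 1
    push_cast
    ring

/-- The coefficient of the `k`-th term in `p_{n,2} - (γ² + (2a - 1)π²/6) q_n`, after reversing
the order of summation. -/
noncomputable def errCoeff (a n k : ℕ) : ℝ :=
  (r1 a n (n - k) : ℝ) ^ 2 + r2 a n (n - k) -
    (Real.eulerMascheroniConstant ^ 2 + (2 * (a : ℝ) - 1) * Real.pi ^ 2 / 6)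

lemma errCoeff_eq {a n k : ℕ} (ha : 1 ≤ a) (hk : k ≤ n) :
    (((n.choose k : ℝ) ^ a * (n - k).factorial * errCoeff a n k : ℝ) : ℂ) =
      deriv (deriv (weight a n)) k -
        2 * Real.eulerMascheroniConstant * deriv (weight a n) k := by
  have h := jet_weight ha hk
  rw [h.fst, h.snd, errCoeff]
  push_cast
  ring

lemma qseq_eq (a n : ℕ) :
    (qseq a n : ℝ) = ∑ k ∈ Finset.range (n + 1), (n.choose k : ℝ) ^ a * (n - k).factorial := by
  rw [qseq, ← Finset.sum_flip]
  push_cast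
  refine Finset.sum_congr rfl fun k hk ↦ ?_
  rw [Nat.choose_symm (Finset.mem_range_succ_iff.1 hk)]

lemma pseq2_sub_eq (a n : ℕ) :
    (pseq2 a n : ℝ) - (Real.eulerMascheroniConstant ^ 2 + (2 * (a : ℝ) - 1) * Real.pi ^ 2 / 6) *
      qseq a n =
    ∑ k ∈ Finset.range (n + 1), (n.choose k : ℝ) ^ a * (n - k).factorial * errCoeff a n k := by
  rw [qseq_eq, pseq2, ← Finset.sum_flip, Finset.mul_sum]
  push_cast
  rw [← Finset.sum_sub_distrib]
  refine Finset.sum_congr rfl fun k hk ↦ ?_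
  rw [Nat.choose_symm (Finset.mem_range_succ_iff.1 hk), errCoeff]
  ring

lemma abs_pseq2_sub_le {a : ℕ} (ha : 3 ≤ a) {n L : ℕ} (hL : L ≤ n) (M : ℕ) :
    |(pseq2 a n : ℝ) - (Real.eulerMascheroniConstant ^ 2 + (2 * (a : ℝ) - 1) * Real.pi ^ 2 / 6) *
      qseq a n| ≤
    ‖∑ j ∈ Finset.range (M + (L + 1)), deriv (deriv (weight a n)) ((-(M : ℤ) + j : ℤ) : ℂ)‖ +
    2 * ‖∑ j ∈ Finset.range (M + (L + 1)), deriv (weight a n) ((-(M : ℤ) + j : ℤ) : ℂ)‖ +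
    ∑ k ∈ Finset.Ico (L + 1) (n + 1),
      (n.choose k : ℝ) ^ a * (n - k).factorial * |errCoeff a n k| := by
  rw [pseq2_sub_eq, sum_int_range_eq (fun k ↦ (deriv_weight_neg ha n k).2),
    sum_int_range_eq (fun k ↦ (deriv_weight_neg ha n k).1),
    ← Finset.sum_range_add_sum_Ico _ (Nat.succ_le_succ hL)]
  refine (abs_add_le _ _).trans (add_le_add ?_ ?_)
  · rw [← Real.norm_eq_abs, ← Complex.norm_real, ofReal_sum,
      Finset.sum_congr rfl fun k hk ↦ errCoeff_eq (by omega : 1 ≤ a)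
        ((Finset.mem_range_succ_iff.1 hk).trans hL),
      Finset.sum_sub_distrib, ← Finset.mul_sum]
    refine (norm_sub_le _ _).trans (add_le_add le_rfl ?_)
    rw [norm_mul, norm_mul, Complex.norm_real, Real.norm_eq_abs]
    have h1 : |Real.eulerMascheroniConstant| ≤ 1 := by
      rw [abs_le]
      constructor <;> linarith [Real.one_half_lt_eulerMascheroniConstant,
        Real.eulerMascheroniConstant_lt_two_thirds]
    have h2 : ‖(2 : ℂ)‖ = 2 := by simp
    rw [h2]
    exact mul_le_mul_of_nonneg_right (by linarith) (norm_nonneg _)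
  · refine (Finset.abs_sum_le_sum_abs _ _).trans (Finset.sum_le_sum fun k _ ↦ ?_)
    rw [abs_mul, abs_of_nonneg (by positivity : (0 : ℝ) ≤ (n.choose k : ℝ) ^ a * (n - k).factorial)]

end jet

section rotated

open Complex Filter Topology MeasureTheory

lemma integrableOn_rpow_mul_exp_neg_mul {u b : ℝ} (hu : 0 < u) (hb : 0 < b) :
    IntegrableOn (fun t : ℝ ↦ t ^ (u - 1) * Real.exp (-b * t)) (Set.Ioi 0) := by
  have h := integrableOn_rpow_mul_exp_neg_mul_rpow (p := 1) (s := u - 1) (b := b) (by linarith)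
    one_pos hb
  simpa using h

lemma norm_cpow_mul_exp_neg {z r : ℂ} {t : ℝ} (ht : 0 < t) :
    ‖(t : ℂ) ^ (z - 1) * exp (-(r * t))‖ = t ^ (z.re - 1) * Real.exp (-r.re * t) := by
  rw [norm_mul, norm_cpow_eq_rpow_re_of_pos ht, norm_exp]
  simp

lemma hasDerivAt_laplace_cpow {z r : ℂ} (hz : 0 < z.re) (hr : 0 < r.re) :
    ∃ d, HasDerivAt (fun r : ℂ ↦ ∫ t : ℝ in Set.Ioi 0, (t : ℂ) ^ (z - 1) * exp (-(r * t))) d r := by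
  have hs : {w : ℂ | r.re / 2 < w.re} ∈ 𝓝 r :=
    (isOpen_lt continuous_const continuous_re).mem_nhds (by simp; linarith)
  have hm : ∀ w : ℂ, AEStronglyMeasurable (fun t : ℝ ↦ (t : ℂ) ^ (z - 1) * exp (-(w * t)))
      (volume.restrict (Set.Ioi 0)) := fun w ↦ by
    refine ContinuousOn.aestronglyMeasurable ?_ measurableSet_Ioi
    refine ContinuousOn.mul ?_ (by fun_prop)
    exact fun t ht ↦ (continuousAt_ofReal_cpow_const t (z - 1) (Or.inr (ne_of_gt ht))).continuousWithinAt
  refine ⟨_, (hasDerivAt_integral_of_dominated_loc_of_deriv_le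
    (F' := fun w t ↦ -(t : ℂ) * ((t : ℂ) ^ (z - 1) * exp (-(w * t))))
    (bound := fun t ↦ t ^ (z.re + 1 - 1) * Real.exp (-(r.re / 2) * t)) hs
    (Eventually.of_forall hm) ?_ ?_ ?_ ?_ ?_).2⟩
  · refine (integrable_norm_iff (hm r)).1 ?_
    refine (integrableOn_rpow_mul_exp_neg_mul hz hr).congr_fun
      (fun t ht ↦ (norm_cpow_mul_exp_neg ht).symm) measurableSet_Ioi
  · exact (by fun_prop : Continuous fun t : ℝ ↦ -(t : ℂ)).aestronglyMeasurable.mul (hm r)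
  · refine (ae_restrict_iff' measurableSet_Ioi).2 (Eventually.of_forall fun t ht w hw ↦ ?_)
    have ht' : (0 : ℝ) < t := ht
    rw [norm_mul, norm_cpow_mul_exp_neg ht', norm_neg, Complex.norm_real, Real.norm_eq_abs,
      abs_of_pos ht', ← mul_assoc, add_sub_right_comm, Real.rpow_add ht', Real.rpow_one,
      mul_comm t]
    have : r.re / 2 < w.re := hw
    gcongr
  · exact integrableOn_rpow_mul_exp_neg_mul (by linarith) (by linarith)
  · refine Eventually.of_forall fun t w _ ↦ ?_
    have h := (((hasDerivAt_id w).mul_const (t : ℂ)).neg.cexp).const_mul ((t : ℂ) ^ (z - 1))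
    convert! h using 1
    simp
    ring

/-- The Laplace transform of a power at a complex argument. -/
lemma laplace_cpow {z r : ℂ} (hz : 0 < z.re) (hr : 0 < r.re) :
    ∫ t : ℝ in Set.Ioi 0, (t : ℂ) ^ (z - 1) * exp (-(r * t)) = r ^ (-z) * Gamma z := by
  have hU : IsOpen {w : ℂ | 0 < w.re} := isOpen_lt continuous_const continuous_re
  have hc : IsPreconnected {w : ℂ | 0 < w.re} := (convex_halfSpace_re_gt 0).isPreconnected
  have hf : AnalyticOnNhd ℂ
      (fun r : ℂ ↦ ∫ t : ℝ in Set.Ioi 0, (t : ℂ) ^ (z - 1) * exp (-(r * t))) {w : ℂ | 0 < w.re} := by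
    refine DifferentiableOn.analyticOnNhd (fun w hw ↦ ?_) hU
    obtain ⟨d, hd⟩ := hasDerivAt_laplace_cpow hz hw
    exact hd.differentiableAt.differentiableWithinAt
  have hg : AnalyticOnNhd ℂ (fun r : ℂ ↦ r ^ (-z) * Gamma z) {w : ℂ | 0 < w.re} := by
    refine DifferentiableOn.analyticOnNhd (fun w hw ↦ ?_) hU
    refine DifferentiableAt.differentiableWithinAt ?_
    refine DifferentiableAt.mul_const ?_ _
    exact differentiableAt_id.cpow_const (Or.inl hw)
  refine hf.eqOn_of_preconnected_of_frequently_eq hg hc (z₀ := 1) (by simp) ?_ hr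
  have h1 : ∀ᶠ n : ℕ in atTop, (1 + 1 / ((n : ℂ) + 1)) ∈
      {w : ℂ | (∫ t : ℝ in Set.Ioi 0, (t : ℂ) ^ (z - 1) * exp (-(w * t))) =
        w ^ (-z) * Gamma z} := by
    refine Eventually.of_forall fun n ↦ ?_
    have hp : (0 : ℝ) < 1 + 1 / ((n : ℝ) + 1) := by positivity
    have h := integral_cpow_mul_exp_neg_mul_Ioi hz hp
    push_cast at h
    simp only [Set.mem_ofPred_eq]
    rw [h, one_div, inv_cpow, cpow_neg]
    have : (1 + 1 / ((n : ℂ) + 1)) = ((1 + 1 / ((n : ℝ) + 1) : ℝ) : ℂ) := by push_cast; rfl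
    rw [this, arg_ofReal_of_nonneg hp.le]
    exact Real.pi_pos.ne
  have h2 : Tendsto (fun n : ℕ ↦ (1 + 1 / ((n : ℂ) + 1))) atTop (𝓝[≠] 1) := by
    refine tendsto_nhdsWithin_iff.2 ⟨?_, Eventually.of_forall fun n ↦ ?_⟩
    · simpa using (tendsto_one_div_add_atTop_nhds_zero_nat (𝕜 := ℂ)).const_add 1
    · have : ((n : ℂ) + 1) ≠ 0 := by exact_mod_cast n.succ_ne_zero
      simp [this]
  exact h2.frequently h1.frequently

lemma norm_Gamma_mul_exp_le_of_nonneg {u α : ℝ} (hu : 0 < u) (h0 : 0 ≤ α) (h1 : α < Real.pi / 2)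
    (y : ℝ) : ‖Gamma (u + y * I)‖ * Real.exp (α * y) ≤ (1 / Real.cos α) ^ u * Real.Gamma u := by
  have hc : 0 < Real.cos α := Real.cos_pos_of_mem_Ioo ⟨by linarith, h1⟩
  set z : ℂ := u + y * I
  have hz : z.re = u := by simp [z]
  set r : ℂ := exp (α * I)
  have hr : r.re = Real.cos α := by simp [r, exp_ofReal_mul_I_re]
  have key := laplace_cpow (z := z) (r := r) (by rwa [hz]) (by rwa [hr])
  have e1 : ‖r ^ (-z)‖ = Real.exp (α * y) := by
    rw [cpow_def_of_ne_zero (exp_ne_zero _), log_exp (by simp; linarith [Real.pi_pos])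
      (by simp; linarith [Real.pi_pos]), norm_exp]
    simp [z]
  rw [mul_comm, ← e1, ← norm_mul, ← key]
  refine (norm_integral_le_integral_norm _).trans (le_of_eq ?_)
  rw [← Real.integral_rpow_mul_exp_neg_mul_Ioi hu hc]
  refine setIntegral_congr_fun measurableSet_Ioi fun t ht ↦ ?_
  rw [norm_cpow_mul_exp_neg ht, hz, hr, neg_mul]

lemma norm_Gamma_mul_exp_le {u α : ℝ} (hu : 0 < u) (h0 : 0 ≤ α) (h1 : α < Real.pi / 2)
    (y : ℝ) : ‖Gamma (u + y * I)‖ * Real.exp (α * |y|) ≤ (1 / Real.cos α) ^ u * Real.Gamma u := by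
  rcases abs_cases y with ⟨h, -⟩ | ⟨h, -⟩ <;> rw [h]
  · exact norm_Gamma_mul_exp_le_of_nonneg hu h0 h1 y
  · have := norm_Gamma_mul_exp_le_of_nonneg hu h0 h1 (-y)
    rw [← norm_Gamma_conj] at this
    simpa using this

end rotated

section scaled

open Complex

lemma factorial_le_rpow_mul_Gamma {n : ℕ} (hn : 1 ≤ n) {u : ℝ} (hu : u ≤ n / 2) :
    (n.factorial : ℝ) ≤ (n : ℝ) ^ u * Real.exp 1 * Real.Gamma (n - u + 1) := by
  have hn' : (1 : ℝ) ≤ n := by exact_mod_cast hn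
  have hg : 0 < Real.Gamma (n - u + 1) := Real.Gamma_pos_of_pos (by linarith)
  have hg1 : 0 < Real.Gamma ((n : ℝ) + 1) := Real.Gamma_pos_of_pos (by linarith)
  have hg0 : 0 < Real.Gamma (n : ℝ) := Real.Gamma_pos_of_pos (by linarith)
  rw [← Real.Gamma_nat_eq_factorial, Real.rpow_def_of_pos (by linarith), ← Real.exp_log hg,
    ← Real.exp_add, ← Real.exp_add, ← Real.exp_log hg1]
  refine Real.exp_le_exp.2 ?_
  have hc := Real.convexOn_log_Gamma
  rcases lt_trichotomy u 0 with h | h | h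
  · have := hc.slope_mono_adjacent (x := n) (y := n + 1) (z := n - u + 1)
      (Set.mem_Ioi.2 (by linarith)) (Set.mem_Ioi.2 (by linarith)) (by linarith) (by linarith)
    simp only [Function.comp] at this
    rw [add_sub_cancel_left, div_one, le_div_iff₀ (by linarith),
      Real.Gamma_add_one (by linarith : (n : ℝ) ≠ 0), Real.log_mul (by linarith) hg0.ne',
      add_sub_cancel_right, ← Real.log_mul (by linarith) hg0.ne',
      ← Real.Gamma_add_one (by linarith : (n : ℝ) ≠ 0)] at this
    linarith
  · subst h
    simp
  · have := hc.slope_mono_adjacent (x := n - u + 1) (y := n + 1) (z := n + 1 + 1)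
      (Set.mem_Ioi.2 (by linarith)) (Set.mem_Ioi.2 (by linarith)) (by linarith) (by linarith)
    simp only [Function.comp] at this
    rw [add_sub_cancel_left, div_one, div_le_iff₀ (by linarith),
      Real.Gamma_add_one (by linarith : (n : ℝ) + 1 ≠ 0), Real.log_mul (by linarith) hg1.ne',
      add_sub_cancel_right] at this
    have h2 : Real.log ((n : ℝ) + 1) ≤ Real.log n + 1 / n := by
      rw [show (n : ℝ) + 1 = n * (1 + 1 / n) by field_simp,
        Real.log_mul (by linarith) (by positivity)]
      have := Real.log_le_sub_one_of_pos (show 0 < 1 + 1 / (n : ℝ) by positivity)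
      linarith
    have h3 : Real.log ((n : ℝ) + 1) * u ≤ Real.log n * u + 1 := by
      calc _ ≤ (Real.log n + 1 / n) * u := by gcongr
        _ = Real.log n * u + u / n := by ring
        _ ≤ _ := by
          have : u / n ≤ 1 := by rw [div_le_one (by linarith)]; linarith
          linarith
    have h4 : (n : ℝ) + 1 - (n - u + 1) = u := by ring
    rw [h4] at this
    linarith

lemma factorial_mul_norm_invFactorial_sub_le {n : ℕ} (hn : 1 ≤ n) {z : ℂ} {Y : ℝ}
    (hz : z.re ≤ n / 2) (hy : |z.im| ≤ Y) :
    n.factorial * ‖invFactorial (n - z)‖ ≤ (n : ℝ) ^ z.re * Real.exp (1 + Y ^ 2 / n) := by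
  have hn' : (1 : ℝ) ≤ n := by exact_mod_cast hn
  have h1 := Gamma_le_norm_Gamma_mul_exp (v := n - z.re + 1) (by linarith) (-z.im)
  have e : (n : ℂ) - z + 1 = ((n - z.re + 1 : ℝ) : ℂ) + ((-z.im : ℝ) : ℂ) * I := by
    apply Complex.ext <;> simp
  have hg : 0 < Real.Gamma (n - z.re + 1) := Real.Gamma_pos_of_pos (by linarith)
  have hg' : 0 < ‖Gamma ((n - z.re + 1 : ℝ) + ((-z.im : ℝ) : ℂ) * I)‖ := by
    by_contra h
    rw [not_lt] at h
    nlinarith [Real.exp_pos ((-z.im) ^ 2 / (2 * (n - z.re + 1 - 1)))]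
  rw [invFactorial, e, norm_inv, ← div_eq_mul_inv, div_le_iff₀ hg']
  refine (factorial_le_rpow_mul_Gamma hn hz).trans ?_
  have h2 : (-z.im) ^ 2 / (2 * (n - z.re + 1 - 1)) ≤ Y ^ 2 / n := by
    have : (-z.im) ^ 2 ≤ Y ^ 2 := by
      rw [neg_sq]
      exact sq_le_sq' (by linarith [neg_abs_le z.im]) ((le_abs_self _).trans hy)
    gcongr
    linarith
  rw [Real.exp_add, ← mul_assoc, mul_assoc _ (Real.exp (Y ^ 2 / n))]
  gcongr
  refine h1.trans ?_
  rw [mul_comm]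
  gcongr

/-- `x ^ Re s / |Γ(s + 1)|`. -/
noncomputable def scaled (x : ℝ) (s : ℂ) : ℝ := x ^ s.re * ‖invFactorial s‖

lemma scaled_nonneg {x : ℝ} (hx : 0 < x) (s : ℂ) : 0 ≤ scaled x s := by
  unfold scaled; positivity

lemma norm_weight_le {a n : ℕ} (ha : 1 ≤ a) (hn : 1 ≤ n) {x : ℝ} (hx : 0 < x)
    (hxa : x ^ a = (n : ℝ) ^ (a - 1)) {z : ℂ} {Y : ℝ} (hz : z.re ≤ n / 2) (hy : |z.im| ≤ Y) :
    ‖weight a n z‖ ≤ n.factorial * Real.exp (1 + Y ^ 2 / n) ^ (a - 1) * scaled x z ^ a := by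
  obtain ⟨b, rfl⟩ := Nat.exists_eq_add_of_le' ha
  simp only [Nat.add_sub_cancel] at *
  have h := factorial_mul_norm_invFactorial_sub_le hn hz hy
  have e : ((n : ℝ) ^ z.re) ^ b = (x ^ z.re) ^ (b + 1) := by
    rw [← Real.rpow_natCast, ← Real.rpow_natCast, ← Real.rpow_mul (by positivity),
      ← Real.rpow_mul hx.le, mul_comm, mul_comm z.re, Real.rpow_mul (by positivity),
      Real.rpow_mul hx.le, Real.rpow_natCast, Real.rpow_natCast, hxa]
  rw [weight, norm_mul, norm_mul, norm_pow, norm_pow, norm_pow, Nat.add_sub_cancel, norm_natCast,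
    scaled, mul_pow, ← e]
  calc _ = n.factorial * (n.factorial * ‖invFactorial (n - z)‖) ^ b *
        ‖invFactorial z‖ ^ (b + 1) := by ring
    _ ≤ n.factorial * ((n : ℝ) ^ z.re * Real.exp (1 + Y ^ 2 / n)) ^ b *
        ‖invFactorial z‖ ^ (b + 1) := by gcongr
    _ = _ := by ring

lemma scaled_shift {x : ℝ} (hx : 0 < x) (s : ℂ) :
    scaled x s = ‖s + 1‖ / x * scaled x (s + 1) := by
  have h := invFactorial_sub_one (s + 1)
  rw [add_sub_cancel_right] at h
  rw [scaled, scaled, h, norm_mul, add_re, one_re, Real.rpow_add_one hx.ne']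
  field_simp

lemma scaled_le_pow_mul {x C : ℝ} (hx : 0 < x) (s : ℂ) (m : ℕ)
    (h : ∀ j < m, ‖s + j + 1‖ ≤ C * x) : scaled x s ≤ C ^ m * scaled x (s + m) := by
  induction m with
  | zero => simp
  | succ m ih =>
    refine (ih fun j hj ↦ h j (by omega)).trans ?_
    have h1 := h m (by omega)
    have hC : 0 ≤ C := nonneg_of_mul_nonneg_left ((norm_nonneg _).trans h1) hx
    rw [scaled_shift hx, pow_succ, mul_assoc]
    have h2 : ‖s + m + 1‖ / x ≤ C := by rwa [div_le_iff₀ hx]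
    have h3 := scaled_nonneg hx (s + m + 1)
    push_cast
    rw [← add_assoc]
    gcongr

lemma scaled_eq_abs (x : ℝ) (z : ℂ) :
    scaled x z = x ^ z.re * ‖Gamma (((z.re + 1 : ℝ) : ℂ) + (|z.im| : ℝ) * I)‖⁻¹ := by
  have e : z + 1 = ((z.re + 1 : ℝ) : ℂ) + (z.im : ℝ) * I := by apply Complex.ext <;> simp
  rw [scaled, invFactorial, norm_inv, e]
  rcases abs_cases z.im with ⟨h, -⟩ | ⟨h, -⟩ <;> rw [h]
  rw [← norm_Gamma_conj]
  simp [sub_eq_add_neg]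

lemma scaled_top_le {x : ℝ} (hx : 1 ≤ x) {z : ℂ} (hu : 0 ≤ z.re) (hy : 1 ≤ |z.im|) {P : ℝ}
    (hP : 0 < P)
    (h : ∀ m : ℕ, P ≤ ∏ j ∈ Finset.range m, (√(((j : ℝ) + 1) ^ 2 + |z.im| ^ 2) / x)) :
    scaled x z ≤ 2 * x * (Real.exp (Real.pi * |z.im| / 2) / P) := by
  set m := ⌊z.re⌋₊
  have hm := h m
  rw [Finset.prod_div_distrib, Finset.prod_const, Finset.card_range, le_div_iff₀ (by positivity)]
    at hm
  have h1 := prod_le_norm_Gamma hu hy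
  have e1 : ((z.re + 1 : ℝ) : ℂ) = (z.re : ℂ) + 1 := by push_cast; rfl
  rw [scaled_eq_abs, e1]
  have h2 : Real.exp (-(Real.pi * |z.im| / 2)) / 2 * (P * x ^ m) ≤
      ‖Gamma ((z.re : ℂ) + 1 + (|z.im| : ℝ) * I)‖ := le_trans (by gcongr) h1
  have h3 : x ^ z.re ≤ x ^ m * x := by
    rw [← pow_succ, ← Real.rpow_natCast]
    refine Real.rpow_le_rpow_of_exponent_le hx ?_
    push_cast
    exact (Nat.lt_floor_add_one _).le
  have hxm : 0 < x ^ m := by positivity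
  calc _ ≤ x ^ m * x * (Real.exp (-(Real.pi * |z.im| / 2)) / 2 * (P * x ^ m))⁻¹ := by gcongr
    _ = _ := by
      rw [Real.exp_neg]
      field_simp

lemma scaled_top_sin_le {x : ℝ} (hx : 1 ≤ x) {θ : ℝ} (h0 : 0 < θ) (h1 : θ ≤ Real.pi / 2) {z : ℂ}
    (hu : 0 ≤ z.re) (hy : |z.im| = x * Real.sin θ) (hy1 : 1 ≤ |z.im|) :
    scaled x z ≤ 2 * x * Real.exp (θ * |z.im| + x * Real.cos θ) := by
  refine (scaled_top_le hx hu hy1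
    (P := Real.exp (x * Real.sin θ * (Real.pi / 2 - θ) - x * Real.cos θ))
    (Real.exp_pos _) fun m ↦ ?_).trans_eq ?_
  · rw [hy]
    exact exp_le_prod_sqrt (by linarith) h0 h1 m
  · rw [← Real.exp_sub, hy]
    congr 2
    ring

lemma norm_le_abs_add_abs (z : ℂ) {A B : ℝ} (h1 : |z.re| ≤ A) (h2 : |z.im| ≤ B) : ‖z‖ ≤ A + B :=
  (norm_le_abs_re_add_abs_im z).trans (add_le_add h1 h2)

lemma scaled_top_sin_le' {x : ℝ} (hx : 1 ≤ x) {θ : ℝ} (h0 : 0 < θ) (h1 : θ ≤ Real.pi / 2) {z : ℂ}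
    (hu : -(1 / 2) ≤ z.re) (hy : |z.im| = x * Real.sin θ) (hy1 : 1 ≤ |z.im|) :
    scaled x z ≤ 4 * x * Real.exp (θ * |z.im| + x * Real.cos θ) := by
  rcases le_or_gt 0 z.re with h | h
  · refine (scaled_top_sin_le hx h0 h1 h hy hy1).trans ?_
    gcongr
    norm_num
  · have h2 := scaled_top_sin_le (z := z + 1) hx h0 h1 (by simp; linarith) (by simpa) (by simpa)
    have h3 : ‖z + 1‖ ≤ x + x := by
      refine norm_le_abs_add_abs _ ?_ ?_
      · rw [add_re, one_re, abs_of_nonneg] <;> linarith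
      · rw [add_im, one_im, add_zero, hy]
        nlinarith [Real.sin_le_one θ]
    rw [scaled_shift (by linarith)]
    simp only [add_im, one_im, add_zero] at h2
    have h4 : ‖z + 1‖ / x ≤ 2 := by rw [div_le_iff₀ (by linarith)]; linarith
    calc _ ≤ 2 * (2 * x * Real.exp (θ * |z.im| + x * Real.cos θ)) :=
        mul_le_mul h4 h2 (scaled_nonneg (by linarith) _) (by norm_num)
      _ = _ := by ring

lemma scaled_neg_half_le {x : ℝ} (hx : 1 ≤ x) {z : ℂ} (hu : z.re = -(1 / 2)) :
    scaled x z ≤ Real.exp (Real.pi * |z.im| / 2) := by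
  have h := exp_le_norm_Gamma_half_add |z.im|
  rw [abs_abs] at h
  rw [scaled_eq_abs, hu]
  have e : ((-(1 / 2) + 1 : ℝ) : ℂ) = 1 / 2 := by push_cast; norm_num
  have h1 : x ^ (-(1 / 2) : ℝ) ≤ 1 := Real.rpow_le_one_of_one_le_of_nonpos hx (by norm_num)
  rw [e]
  calc _ ≤ 1 * (Real.exp (-(Real.pi * |z.im| / 2)))⁻¹ := by
        have := Real.exp_pos (-(Real.pi * |z.im| / 2))
        gcongr
    _ = _ := by rw [one_mul, ← Real.exp_neg, neg_neg]

end scaled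

section contour

open Complex

lemma pow_div_factorial_le {x : ℝ} (hx : 0 ≤ x) {k : ℕ} (h : 27 * x ≤ k) :
    x ^ k / k.factorial ≤ Real.exp (-(2 * k)) := by
  have h1 := Real.pow_div_factorial_le_exp (27 * x) (by linarith) k
  have h2 : Real.exp (27 * x) ≤ Real.exp k := Real.exp_le_exp.2 h
  have h3 : Real.exp 3 ≤ 27 := by
    have h4 : Real.exp 3 = Real.exp 1 ^ 3 := by rw [← Real.exp_nat_mul]; norm_num
    have h5 := Real.exp_one_lt_three
    rw [h4]
    calc Real.exp 1 ^ 3 ≤ 3 ^ 3 := by gcongr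
      _ = 27 := by norm_num
  have h6 : Real.exp (3 * k) ≤ 27 ^ k := by
    rw [mul_comm, Real.exp_nat_mul]; gcongr
  have h7 : x ^ k / k.factorial * 27 ^ k ≤ Real.exp k := by
    calc _ = (27 * x) ^ k / k.factorial := by rw [mul_pow]; ring
      _ ≤ _ := h1.trans h2
  calc _ = x ^ k / k.factorial * 27 ^ k / 27 ^ k := by field_simp
    _ ≤ Real.exp k / Real.exp (3 * k) := by gcongr
    _ = _ := by rw [← Real.exp_sub]; congr 1; ring

lemma factorial_mul_exp_le {k : ℕ} (hk : 1 ≤ k) :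
    (k.factorial : ℝ) * Real.exp k ≤ Real.exp 1 * (k : ℝ) ^ (k + 1) := by
  induction k, hk using Nat.le_induction with
  | base => simp
  | succ k hk ih =>
    have hk' : (0 : ℝ) < k := by exact_mod_cast hk
    have h1 : Real.exp 1 * (k : ℝ) ^ (k + 1) ≤ ((k : ℝ) + 1) ^ (k + 1) := by
      have h2 : Real.exp (1 / (k + 1)) ≤ (k + 1) / k := by
        rw [← Real.le_log_iff_exp_le (by positivity)]
        have h3 := Real.log_le_sub_one_of_pos (show 0 < (k : ℝ) / (k + 1) by positivity)
        rw [← inv_div (k : ℝ), Real.log_inv]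
        have h4 : (k : ℝ) / (k + 1) - 1 = -(1 / (k + 1)) := by field_simp; ring
        linarith
      have h5 : Real.exp 1 = Real.exp (1 / ((k : ℝ) + 1)) ^ (k + 1) := by
        rw [← Real.exp_nat_mul]
        congr 1
        push_cast
        field_simp
      calc _ ≤ (((k : ℝ) + 1) / k) ^ (k + 1) * (k : ℝ) ^ (k + 1) := by rw [h5]; gcongr
        _ = _ := by rw [← mul_pow]; congr 1; field_simp
    push_cast [Nat.factorial_succ]
    rw [Real.exp_add]
    calc ((k : ℝ) + 1) * k.factorial * (Real.exp k * Real.exp 1)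
        = (k + 1) * Real.exp 1 * (k.factorial * Real.exp k) := by ring
      _ ≤ (k + 1) * Real.exp 1 * (Real.exp 1 * (k : ℝ) ^ (k + 1)) := by gcongr
      _ ≤ (k + 1) * Real.exp 1 * ((k : ℝ) + 1) ^ (k + 1) := by gcongr
      _ = _ := by ring

lemma scaled_right_le {x : ℝ} (hx : 1 ≤ x) {L : ℕ} (hL : 27 * x ≤ L) {z : ℂ}
    (hz : z.re = L + 1 / 2) (hy : |z.im| ≤ 3 * x) : scaled x z ≤ x * Real.exp (-x) := by
  have h1 := Gamma_le_norm_Gamma_mul_exp (v := z.re + 1) (by linarith) |z.im|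
  have h2 : (L.factorial : ℝ) ≤ Real.Gamma (z.re + 1) := by
    rw [← Real.Gamma_nat_eq_factorial]
    exact Real.Gamma_strictMonoOn_Ici.monotoneOn (Set.mem_Ici.2 (by linarith))
      (Set.mem_Ici.2 (by linarith)) (by linarith)
  have h3 : |z.im| ^ 2 / (2 * (z.re + 1 - 1)) ≤ x := by
    rw [div_le_iff₀ (by linarith)]
    nlinarith [abs_nonneg z.im]
  have h4 : (L.factorial : ℝ) ≤ ‖Gamma (((z.re + 1 : ℝ) : ℂ) + (|z.im| : ℝ) * I)‖ * Real.exp x :=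
    h2.trans (h1.trans (by gcongr))
  have h5 : x ^ z.re ≤ x ^ L * x := by
    rw [← pow_succ, ← Real.rpow_natCast]
    refine Real.rpow_le_rpow_of_exponent_le hx ?_
    push_cast
    linarith
  have hf : (0 : ℝ) < L.factorial := by exact_mod_cast L.factorial_pos
  have h6 : ‖Gamma (((z.re + 1 : ℝ) : ℂ) + (|z.im| : ℝ) * I)‖⁻¹ ≤ Real.exp x / L.factorial := by
    have h7 : L.factorial / Real.exp x ≤ ‖Gamma (((z.re + 1 : ℝ) : ℂ) + (|z.im| : ℝ) * I)‖ := by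
      rwa [div_le_iff₀ (Real.exp_pos _)]
    rw [← inv_div]
    exact inv_anti₀ (by positivity) h7
  rw [scaled_eq_abs]
  calc _ ≤ x ^ L * x * (Real.exp x / L.factorial) := by gcongr
    _ = x * ((x ^ L / L.factorial) * Real.exp x) := by ring
    _ ≤ x * (Real.exp (-(2 * L)) * Real.exp x) := by
        gcongr; exact pow_div_factorial_le (by linarith) hL
    _ ≤ _ := by
        rw [← Real.exp_add]
        gcongr
        linarith

lemma norm_invFactorial_le_reflect {z : ℂ} (h : sin (Real.pi * z) ≠ 0) :
    ‖invFactorial z‖ ≤ ‖Gamma (-z)‖ * Real.exp (Real.pi * |z.im|) := by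
  have h1 := Gamma_mul_Gamma_one_sub (-z)
  rw [sub_neg_eq_add, mul_neg, sin_neg, add_comm, eq_div_iff (neg_ne_zero.2 h)] at h1
  have hpi : (Real.pi : ℂ) ≠ 0 := by exact_mod_cast Real.pi_ne_zero
  have hG : Gamma (z + 1) ≠ 0 := fun h0 ↦ by
    rw [h0, mul_zero, zero_mul] at h1
    exact hpi h1.symm
  have h2 : invFactorial z = Gamma (-z) * -sin (Real.pi * z) / Real.pi := by
    rw [invFactorial, eq_div_iff hpi, inv_mul_eq_div, div_eq_iff hG]
    linear_combination -h1
  rw [h2, norm_div, norm_mul, norm_neg, Complex.norm_real, Real.norm_eq_abs,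
    abs_of_pos Real.pi_pos, div_le_iff₀ Real.pi_pos]
  have h3 := norm_sin_pi_le z
  have h4 : 1 ≤ Real.pi := by linarith [Real.pi_gt_three]
  calc _ ≤ ‖Gamma (-z)‖ * Real.exp (Real.pi * |z.im|) * 1 := by rw [mul_one]; gcongr
    _ ≤ _ := by gcongr

lemma scaled_left_le {x : ℝ} (hx : 4 ≤ x) {z : ℂ} (hz : z.re = -(⌊x / 2⌋₊ : ℝ) - 1 / 2) :
    scaled x z ≤ 16 * x * Real.exp (2 * Real.pi * |z.im| / 3 - x / 2) := by
  set M := ⌊x / 2⌋₊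
  have hM2 : 2 ≤ M := Nat.le_floor (by push_cast; linarith)
  have hM2' : (2 : ℝ) ≤ M := by exact_mod_cast hM2
  have hM : (M : ℝ) ≤ x / 2 := Nat.floor_le (by linarith)
  have hM' : x / 2 < M + 1 := Nat.lt_floor_add_one _
  have hsin : sin (Real.pi * z) ≠ 0 :=
    sin_pi_ne_zero (Or.inr ⟨-(M : ℤ), by rw [hz]; push_cast; ring⟩)
  have h1 := norm_invFactorial_le_reflect hsin
  have h2 := norm_Gamma_mul_exp_le (u := M + 1 / 2) (α := Real.pi / 3) (by positivity)
    (by positivity) (by linarith [Real.pi_pos]) (-z.im)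
  have e : ((M + 1 / 2 : ℝ) : ℂ) + (-z.im : ℝ) * I = -z := by
    apply Complex.ext <;> simp [hz]
    ring
  rw [e, abs_neg, Real.cos_pi_div_three, one_div_one_div] at h2
  have h3 : Real.Gamma (M + 1 / 2) ≤ M.factorial := by
    rw [← Real.Gamma_nat_eq_factorial]
    exact Real.Gamma_strictMonoOn_Ici.monotoneOn (Set.mem_Ici.2 (by linarith))
      (Set.mem_Ici.2 (by linarith)) (by linarith)
  have h4 := factorial_mul_exp_le (show 1 ≤ M by omega)
  have h5 : x ^ z.re * 2 ^ ((M : ℝ) + 1 / 2) ≤ ((M : ℝ) ^ M)⁻¹ := by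
    have h6 : x ^ z.re = (x⁻¹) ^ ((M : ℝ) + 1 / 2) := by
      rw [Real.inv_rpow (by linarith), ← Real.rpow_neg (by linarith), hz]
      congr 1
      ring
    have h7 : x⁻¹ * 2 ≤ (M : ℝ)⁻¹ := by
      rw [inv_mul_le_iff₀ (by linarith), ← div_eq_mul_inv, le_div_iff₀ (by linarith)]
      linarith
    rw [h6, ← Real.mul_rpow (by positivity) (by norm_num)]
    calc _ ≤ (M : ℝ)⁻¹ ^ ((M : ℝ) + 1 / 2) := by gcongr
      _ ≤ (M : ℝ)⁻¹ ^ (M : ℝ) := by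
        apply Real.rpow_le_rpow_of_exponent_ge (by positivity)
        · exact inv_le_one_of_one_le₀ (by linarith)
        · linarith
      _ = _ := by rw [Real.rpow_natCast, inv_pow]
  have h8 : ‖Gamma (-z)‖ ≤ 2 ^ ((M : ℝ) + 1 / 2) * Real.Gamma (M + 1 / 2) *
      Real.exp (-(Real.pi / 3 * |z.im|)) := by
    rw [Real.exp_neg, ← div_eq_mul_inv, le_div_iff₀ (Real.exp_pos _)]
    exact h2
  have h9 : (M.factorial : ℝ) ≤ Real.exp 1 * (M : ℝ) ^ (M + 1) * Real.exp (-M) := by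
    rw [Real.exp_neg, ← div_eq_mul_inv, le_div_iff₀ (Real.exp_pos _)]
    exact h4
  have hM0 : (0 : ℝ) < (M : ℝ) ^ M := by positivity
  have hx0 : (0 : ℝ) ≤ x ^ z.re := by positivity
  have he : Real.exp 2 ≤ 16 := by
    have h4 : Real.exp 2 = Real.exp 1 ^ 2 := by rw [← Real.exp_nat_mul]; norm_num
    have h5 := Real.exp_one_lt_three
    rw [h4]
    nlinarith [Real.exp_pos 1]
  calc scaled x z ≤ x ^ z.re * (2 ^ ((M : ℝ) + 1 / 2) * Real.Gamma (M + 1 / 2) *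
        Real.exp (-(Real.pi / 3 * |z.im|)) * Real.exp (Real.pi * |z.im|)) := by
        rw [scaled]
        gcongr
        exact h1.trans (by gcongr)
    _ = x ^ z.re * 2 ^ ((M : ℝ) + 1 / 2) * Real.Gamma (M + 1 / 2) *
        Real.exp (2 * Real.pi * |z.im| / 3) := by
        rw [mul_assoc _ (Real.exp _), ← Real.exp_add]
        ring_nf
    _ ≤ ((M : ℝ) ^ M)⁻¹ * (Real.exp 1 * (M : ℝ) ^ (M + 1) * Real.exp (-M)) *
        Real.exp (2 * Real.pi * |z.im| / 3) := by
        gcongr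
        exact h3.trans h9
    _ = M * (Real.exp (1 + -M + 2 * Real.pi * |z.im| / 3)) := by
        rw [Real.exp_add, Real.exp_add, pow_succ]
        field_simp
    _ ≤ x * Real.exp (2 + (2 * Real.pi * |z.im| / 3 - x / 2)) := by
        have : (M : ℝ) ≤ x := by linarith
        have : 1 + -(M : ℝ) + 2 * Real.pi * |z.im| / 3 ≤
          2 + (2 * Real.pi * |z.im| / 3 - x / 2) := by linarith
        gcongr
    _ ≤ _ := by
        rw [Real.exp_add, ← mul_assoc, mul_comm x]
        gcongr

lemma scaled_top_three_le {x : ℝ} (hx : 4 ≤ x) {z : ℂ} (hu : -(x / 2) - 1 / 2 ≤ z.re)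
    (hy : |z.im| = 3 * x) :
    scaled x z ≤ 16 * x * Real.exp (7 / 10 * x + Real.pi * |z.im| / 2) := by
  have hpos : ∀ w : ℂ, 0 ≤ w.re → |w.im| = 3 * x →
      scaled x w ≤ 2 * x * Real.exp (Real.pi * |w.im| / 2) := fun w h0 h1 ↦ by
    have := scaled_top_le (x := x) (z := w) (P := 1) (by linarith) h0 (by linarith) one_pos
      fun m ↦ Finset.one_le_prod fun j _ ↦ by
        rw [one_le_div (by linarith)]
        refine Real.le_sqrt_of_sq_le ?_
        rw [h1]
        nlinarith
    rwa [div_one] at this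
  set m := ⌈-z.re⌉₊
  have hm : -z.re ≤ m := Nat.le_ceil _
  have hm' : (m : ℝ) ≤ x / 2 + 3 / 2 := by
    rcases le_or_gt (-z.re) 0 with h | h
    · rw [show m = 0 from Nat.ceil_eq_zero.2 h]
      push_cast
      linarith
    · linarith [Nat.ceil_lt_add_one h.le]
  have h1 : scaled x z ≤ 4 ^ m * scaled x (z + m) := by
    refine scaled_le_pow_mul (by linarith) z m fun j hj ↦ ?_
    have hj' : (j : ℝ) + 1 ≤ m := by exact_mod_cast hj
    have hjc : (j : ℝ) < -z.re := Nat.lt_ceil.1 hj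
    have : ‖z + j + 1‖ ≤ x + 3 * x := by
      refine norm_le_abs_add_abs _ ?_ ?_
      · simp only [add_re, natCast_re, one_re]
        rw [abs_le]
        constructor <;> linarith
      · simp [hy]
    linarith
  have h2 := hpos (z + m) (by simp; linarith) (by simpa)
  simp only [add_im, natCast_im, add_zero] at h2
  have h3 : (4 : ℝ) ^ m ≤ 8 * Real.exp (7 / 10 * x) := by
    have h4 : (4 : ℝ) ^ m ≤ (2 : ℝ) ^ (3 + x) := by
      rw [show (4 : ℝ) ^ m = (2 : ℝ) ^ (2 * (m : ℝ)) by
        rw [Real.rpow_mul (by norm_num), Real.rpow_natCast]; norm_num]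
      exact Real.rpow_le_rpow_of_exponent_le (by norm_num) (by linarith)
    refine h4.trans ?_
    rw [Real.rpow_add (by norm_num), show (2 : ℝ) ^ (3 : ℝ) = 8 by
      rw [show (3 : ℝ) = ((3 : ℕ) : ℝ) by norm_num, Real.rpow_natCast]; norm_num,
      Real.rpow_def_of_pos (by norm_num)]
    gcongr
    linarith [Real.log_two_lt_d9]
  calc _ ≤ 8 * Real.exp (7 / 10 * x) * (2 * x * Real.exp (Real.pi * |z.im| / 2)) :=
        h1.trans (mul_le_mul h3 h2 (scaled_nonneg (by linarith) _) (by positivity))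
    _ = _ := by rw [Real.exp_add]; ring

end contour

section contour_bound

open Complex

lemma pow_mul_exp_le {a : ℕ} {s x w y c : ℝ} (hs : 0 ≤ s) (hx : 0 ≤ x)
    (h : s ≤ 16 * x * Real.exp w) (hw : a * w - 2 * Real.pi * |y| ≤ a * c * x) :
    s ^ a * Real.exp (-(2 * Real.pi * |y|)) ≤ (16 * x) ^ a * Real.exp (a * c * x) := by
  calc _ ≤ (16 * x * Real.exp w) ^ a * Real.exp (-(2 * Real.pi * |y|)) := by gcongr
    _ = (16 * x) ^ a * Real.exp (a * w - 2 * Real.pi * |y|) := by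
      rw [mul_pow, ← Real.exp_nat_mul, mul_assoc, ← Real.exp_add, sub_eq_add_neg]
    _ ≤ _ := by gcongr

lemma scaled_right_le' {x : ℝ} (hx : 1 ≤ x) {L : ℕ} (hL : 27 * x ≤ L) {z : ℂ}
    (hz : z.re = L + 1 / 2) (hy : |z.im| ≤ 3 * x) : scaled x z ≤ 16 * x * Real.exp (-x) := by
  refine (scaled_right_le hx hL hz hy).trans ?_
  gcongr
  linarith

lemma cos_two_pi_div_three : Real.cos (2 * Real.pi / 3) = -(1 / 2) := by
  rw [show 2 * Real.pi / 3 = Real.pi - Real.pi / 3 by ring, Real.cos_pi_sub,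
    Real.cos_pi_div_three]

lemma contour_bound_three {x : ℝ} (hx : 4 ≤ x) {L : ℕ} (hL : 27 * x ≤ L) {z : ℂ}
    (hz : z ∈ rectBoundary (-(⌊x / 2⌋₊ : ℝ) - 1 / 2) (L + 1 / 2) (3 * x)) :
    scaled x z ^ 3 * Real.exp (-(2 * Real.pi * |z.im|)) ≤
      (16 * x) ^ 3 * Real.exp ((3 : ℕ) * Real.cos (2 * Real.pi / (3 : ℕ)) * x) := by
  have hc : Real.cos (2 * Real.pi / (3 : ℕ)) = -(1 / 2) := by
    push_cast; exact cos_two_pi_div_three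
  have hs : 0 ≤ scaled x z := scaled_nonneg (by linarith) z
  have hM : (⌊x / 2⌋₊ : ℝ) ≤ x / 2 := Nat.floor_le (by linarith)
  have hpi := Real.pi_gt_d2
  rw [hc]
  rcases hz with ⟨h1, h2⟩ | ⟨h1 | h1, h2⟩
  · rw [Set.uIcc_of_le (by
      have h3 : (0 : ℝ) ≤ L := L.cast_nonneg
      have h4 : (0 : ℝ) ≤ ⌊x / 2⌋₊ := Nat.cast_nonneg _
      linarith)] at h1
    refine pow_mul_exp_le hs (by linarith) (scaled_top_three_le hx (by linarith [h1.1]) h2) ?_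
    rw [h2]
    push_cast
    nlinarith
  · refine pow_mul_exp_le hs (by linarith) (scaled_left_le hx h1) ?_
    push_cast
    linarith
  · refine pow_mul_exp_le hs (by linarith) (scaled_right_le' (by linarith) hL h1 h2) ?_
    have : 0 ≤ 2 * Real.pi * |z.im| := by positivity
    push_cast
    linarith

lemma sub_mul_sin_le_cos {θ : ℝ} (h0 : 0 < θ) (h1 : θ ≤ Real.pi / 2) :
    (Real.pi / 2 - θ) * Real.sin θ ≤ Real.cos θ := by
  have h2 := Real.le_tan (x := Real.pi / 2 - θ) (by linarith) (by linarith)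
  rwa [Real.tan_eq_sin_div_cos, Real.sin_pi_div_two_sub, Real.cos_pi_div_two_sub,
    le_div_iff₀ (Real.sin_pos_of_pos_of_lt_pi h0 (by linarith [Real.pi_pos]))] at h2

lemma contour_bound_four {a : ℕ} (ha : 4 ≤ a) {x : ℝ} (hx : 1 ≤ x)
    (hx1 : 1 ≤ x * Real.sin (2 * Real.pi / a)) {L : ℕ} (hL : 27 * x ≤ L) {z : ℂ}
    (hz : z ∈ rectBoundary (-(1 / 2)) (L + 1 / 2) (x * Real.sin (2 * Real.pi / a))) :
    scaled x z ^ a * Real.exp (-(2 * Real.pi * |z.im|)) ≤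
      (16 * x) ^ a * Real.exp (a * Real.cos (2 * Real.pi / a) * x) := by
  have ha' : (4 : ℝ) ≤ a := by exact_mod_cast ha
  have hpi := Real.pi_pos
  set θ := 2 * Real.pi / a
  have hθ : a * θ = 2 * Real.pi := by simp only [θ]; field_simp
  have h0 : 0 < θ := by positivity
  have h1 : θ ≤ Real.pi / 2 := by nlinarith
  have hcos : 0 ≤ Real.cos θ := Real.cos_nonneg_of_mem_Icc ⟨by linarith, h1⟩
  have hs : 0 ≤ scaled x z := scaled_nonneg (by linarith) z
  rcases hz with ⟨h2, h3⟩ | ⟨h2 | h2, h3⟩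
  · rw [Set.uIcc_of_le (by have : (0 : ℝ) ≤ L := L.cast_nonneg; linarith)] at h2
    have h4 := scaled_top_sin_le' hx h0 h1 h2.1 h3 (h3 ▸ hx1)
    refine pow_mul_exp_le hs (by linarith) (h4.trans (by gcongr; norm_num)) ?_
    refine le_of_eq ?_
    linear_combination |z.im| * hθ
  · have h4 := scaled_neg_half_le hx h2
    refine pow_mul_exp_le hs (by linarith)
      (h4.trans (le_mul_of_one_le_left (Real.exp_pos _).le (by linarith))) ?_
    calc _ = a * ((Real.pi / 2 - θ) * |z.im|) := by linear_combination |z.im| * hθ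
      _ ≤ a * ((Real.pi / 2 - θ) * (x * Real.sin θ)) := by
        have : 0 ≤ Real.pi / 2 - θ := by linarith
        gcongr
      _ = a * ((Real.pi / 2 - θ) * Real.sin θ) * x := by ring
      _ ≤ _ := by
        gcongr
        exact sub_mul_sin_le_cos h0 h1
  · have h5 : |z.im| ≤ 3 * x := h3.trans (by nlinarith [Real.sin_le_one θ])
    refine pow_mul_exp_le hs (by linarith) (scaled_right_le' hx hL h2 h5) ?_
    have h6 : 0 ≤ 2 * Real.pi * |z.im| := by positivity
    have h7 : 0 ≤ a * Real.cos θ * x := by positivity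
    have h8 : 0 ≤ (a : ℝ) * x := by positivity
    linarith

/-- There is a contour around `0, …, L` on which the rescaled weight is exponentially small. -/
lemma exists_contour {a : ℕ} (ha : 3 ≤ a) : ∃ X : ℝ, ∀ x : ℝ, X ≤ x → ∀ L : ℕ, 27 * x ≤ L →
    ∃ (M : ℕ) (Y : ℝ), (M : ℝ) ≤ x ∧ 1 ≤ Y ∧ Y ≤ 3 * x ∧
      ∀ z ∈ rectBoundary (-(M : ℝ) - 1 / 2) (L + 1 / 2) Y,
        scaled x z ^ a * Real.exp (-(2 * Real.pi * |z.im|)) ≤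
          (16 * x) ^ a * Real.exp (a * Real.cos (2 * Real.pi / a) * x) := by
  rcases ha.eq_or_lt with rfl | h
  · refine ⟨4, fun x hx L hL ↦ ⟨⌊x / 2⌋₊, 3 * x, ?_, by linarith, le_rfl,
      fun z hz ↦ contour_bound_three hx hL hz⟩⟩
    have := Nat.floor_le (show 0 ≤ x / 2 by linarith)
    linarith
  · have ha' : (4 : ℝ) ≤ a := by exact_mod_cast h
    have hs : 0 < Real.sin (2 * Real.pi / a) := by
      refine Real.sin_pos_of_pos_of_lt_pi (by positivity) ?_
      rw [div_lt_iff₀ (by linarith)]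
      nlinarith [Real.pi_pos]
    refine ⟨max 1 (1 / Real.sin (2 * Real.pi / a)), fun x hx L hL ↦ ?_⟩
    have h1 : 1 ≤ x := (le_max_left _ _).trans hx
    have h2 : 1 ≤ x * Real.sin (2 * Real.pi / a) := by
      rw [← div_le_iff₀ hs]
      exact (le_max_right _ _).trans hx
    refine ⟨0, x * Real.sin (2 * Real.pi / a), by push_cast; linarith, h2,
      by nlinarith [Real.sin_le_one (2 * Real.pi / a)], fun z hz ↦ ?_⟩
    refine contour_bound_four h h1 h2 hL ?_
    convert hz using 1
    push_cast
    ring_nf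

end contour_bound

section real_estimates

open Finset

lemma choose_pow_mul_factorial {n k : ℕ} (hk : k ≤ n) (b : ℕ) :
    (n.choose k : ℝ) ^ (b + 1) * (n - k).factorial =
      n.factorial * ((n.descFactorial k : ℝ) ^ b / (k.factorial : ℝ) ^ (b + 1)) := by
  have h1 : ((n - k).factorial : ℝ) * n.descFactorial k = n.factorial := by
    exact_mod_cast Nat.factorial_mul_descFactorial hk
  have h2 : (n.descFactorial k : ℝ) = k.factorial * n.choose k := by
    exact_mod_cast Nat.descFactorial_eq_factorial_mul_choose n k
  have h3 : (k.factorial : ℝ) ≠ 0 := by exact_mod_cast k.factorial_ne_zero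
  rw [← h1, h2, mul_pow, pow_succ, pow_succ]
  field_simp

lemma pow_pow_of_pow_eq {n b : ℕ} {x : ℝ} (hxa : x ^ (b + 1) = (n : ℝ) ^ b) (k : ℕ) :
    ((n : ℝ) ^ k) ^ b = (x ^ k) ^ (b + 1) := by
  rw [← pow_mul, ← pow_mul, mul_comm k, mul_comm k, pow_mul, pow_mul, hxa]

lemma choose_pow_mul_factorial_le {n k b : ℕ} (hk : k ≤ n) {x : ℝ} (hx : 0 ≤ x)
    (hxa : x ^ (b + 1) = (n : ℝ) ^ b) (h : 27 * x ≤ k) :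
    (n.choose k : ℝ) ^ (b + 1) * (n - k).factorial ≤
      n.factorial * Real.exp (-((b + 1 : ℕ) * x)) := by
  have hd : (n.descFactorial k : ℝ) ≤ (n : ℝ) ^ k := by exact_mod_cast n.descFactorial_le_pow k
  rw [choose_pow_mul_factorial hk]
  refine mul_le_mul_of_nonneg_left ?_ (by positivity)
  calc _ ≤ ((n : ℝ) ^ k) ^ b / (k.factorial : ℝ) ^ (b + 1) := by gcongr
    _ = (x ^ k / k.factorial) ^ (b + 1) := by rw [pow_pow_of_pow_eq hxa, div_pow]
    _ ≤ Real.exp (-(2 * k)) ^ (b + 1) := by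
      gcongr; exact pow_div_factorial_le hx h
    _ ≤ Real.exp (-x) ^ (b + 1) := by
      have : -(2 * (k : ℝ)) ≤ -x := by linarith
      gcongr
    _ = _ := by rw [← Real.exp_nat_mul, mul_neg]

lemma harmonic_mem (m : ℕ) : 0 ≤ (harmonic m : ℝ) ∧ (harmonic m : ℝ) ≤ m := by
  rw [harmonic]
  push_cast
  refine ⟨by positivity, ?_⟩
  calc _ ≤ ∑ i ∈ range m, (1 : ℝ) :=
        sum_le_sum fun i _ ↦ inv_le_one_of_one_le₀ (by linarith [Nat.cast_nonneg (α := ℝ) i])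
    _ = m := by simp

lemma genHarmonic_two_mem (m : ℕ) : 0 ≤ (genHarmonic 2 m : ℝ) ∧ (genHarmonic 2 m : ℝ) ≤ m := by
  rw [genHarmonic]
  push_cast
  refine ⟨by positivity, ?_⟩
  calc _ ≤ ∑ i ∈ range m, (1 : ℝ) := by
        refine sum_le_sum fun i _ ↦ ?_
        rw [one_div]
        exact inv_le_one_of_one_le₀ (one_le_pow₀ (by linarith [Nat.cast_nonneg (α := ℝ) i]))
    _ = m := by simp

lemma abs_errCoeff_le {a n k : ℕ} (ha : 1 ≤ a) (hn : 1 ≤ n) :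
    |errCoeff a n k| ≤ 11 * (a : ℝ) ^ 2 * (n : ℝ) ^ 2 := by
  have ha' : (1 : ℝ) ≤ a := by exact_mod_cast ha
  have hn' : (1 : ℝ) ≤ n := by exact_mod_cast hn
  have hk1 : ((n - (n - k) : ℕ) : ℝ) ≤ n := by exact_mod_cast Nat.sub_le _ _
  have hk2 : ((n - k : ℕ) : ℝ) ≤ n := by exact_mod_cast Nat.sub_le _ _
  have h1 := harmonic_mem (n - (n - k))
  have h2 := harmonic_mem (n - k)
  have h3 := genHarmonic_two_mem (n - (n - k))
  have h4 := genHarmonic_two_mem (n - k)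
  have g1 : Real.eulerMascheroniConstant ^ 2 ≤ 1 := by
    have := Real.eulerMascheroniConstant_lt_two_thirds
    have := Real.one_half_lt_eulerMascheroniConstant
    nlinarith
  have g2 : (2 * (a : ℝ) - 1) * Real.pi ^ 2 / 6 ≤ 4 * a := by
    have : Real.pi ^ 2 ≤ 12 := by nlinarith [Real.pi_lt_d2, Real.pi_pos]
    nlinarith
  have g3 : 0 ≤ (2 * (a : ℝ) - 1) * Real.pi ^ 2 / 6 := by
    have : 0 ≤ 2 * (a : ℝ) - 1 := by linarith
    positivity
  have hr1 : |(r1 a n (n - k) : ℝ)| ≤ 2 * (a * n) := by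
    rw [r1]
    push_cast
    rw [abs_le]
    constructor <;> nlinarith [mul_le_mul_of_nonneg_left (h1.2.trans hk1) (zero_le_one.trans ha'),
      mul_le_mul_of_nonneg_left (h2.2.trans hk2) (sub_nonneg.2 ha'),
      mul_nonneg (zero_le_one.trans ha') h1.1, mul_nonneg (sub_nonneg.2 ha') h2.1]
  have hr1_sq : (r1 a n (n - k) : ℝ) ^ 2 ≤ (2 * (a * n)) ^ 2 :=
    sq_le_sq' (abs_le.1 hr1).1 (abs_le.1 hr1).2
  have hr2 : 0 ≤ (r2 a n (n - k) : ℝ) ∧ (r2 a n (n - k) : ℝ) ≤ 2 * (a * n) := by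
    rw [r2]
    push_cast
    constructor <;> nlinarith [mul_le_mul_of_nonneg_left (h3.2.trans hk1) (zero_le_one.trans ha'),
      mul_le_mul_of_nonneg_left (h4.2.trans hk2) (sub_nonneg.2 ha'),
      mul_nonneg (zero_le_one.trans ha') h3.1, mul_nonneg (sub_nonneg.2 ha') h4.1]
  have b1 : (a : ℝ) * n ≤ (a : ℝ) ^ 2 * (n : ℝ) ^ 2 := by
    rw [← mul_pow]
    nlinarith [mul_le_mul ha' hn' zero_le_one (by positivity)]
  have b2 : (a : ℝ) ≤ a * n := le_mul_of_one_le_right (by positivity) hn'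
  rw [errCoeff, abs_le]
  constructor <;> nlinarith [sq_nonneg (r1 a n (n - k) : ℝ), sq_nonneg Real.eulerMascheroniConstant]

lemma sum_tail_le {n L b : ℕ} (hn : 1 ≤ n) {x : ℝ} (hx : 0 ≤ x)
    (hxa : x ^ (b + 1) = (n : ℝ) ^ b) (h : 27 * x ≤ L) :
    ∑ k ∈ Ico (L + 1) (n + 1), (n.choose k : ℝ) ^ (b + 1) * (n - k).factorial *
      |errCoeff (b + 1) n k| ≤
      11 * ((b + 1 : ℕ) : ℝ) ^ 2 * n ^ 3 * (n.factorial * Real.exp (-((b + 1 : ℕ) * x))) := by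
  have hcard : ((Ico (L + 1) (n + 1)).card : ℝ) ≤ n := by
    rw [Nat.card_Ico]
    exact_mod_cast (by omega)
  calc _ ≤ ∑ k ∈ Ico (L + 1) (n + 1), (n.factorial * Real.exp (-((b + 1 : ℕ) * x))) *
        (11 * ((b + 1 : ℕ) : ℝ) ^ 2 * n ^ 2) := by
        refine sum_le_sum fun k hk ↦ ?_
        rw [mem_Ico] at hk
        have hk' : ((L + 1 : ℕ) : ℝ) ≤ k := by exact_mod_cast hk.1
        push_cast at hk'
        exact mul_le_mul (choose_pow_mul_factorial_le (by omega) hx hxa (by linarith))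
          (abs_errCoeff_le (by omega) hn) (abs_nonneg _) (by positivity)
    _ ≤ n * ((n.factorial * Real.exp (-((b + 1 : ℕ) * x))) *
        (11 * ((b + 1 : ℕ) : ℝ) ^ 2 * n ^ 2)) := by
        rw [sum_const, nsmul_eq_mul]
        gcongr
    _ = _ := by ring

lemma exp_neg_two_mul_le {t : ℝ} (h0 : 0 ≤ t) (h1 : t ≤ 1 / 2) : Real.exp (-(2 * t)) ≤ 1 - t := by
  rw [Real.exp_neg]
  refine inv_le_of_inv_le₀ (by linarith) ?_
  refine le_trans ?_ (Real.add_one_le_exp _)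
  rw [inv_le_iff_one_le_mul₀ (by linarith)]
  nlinarith

lemma le_qseq {n b : ℕ} {x : ℝ} (hx : 1 ≤ x) (hxn : x ≤ n / 2)
    (hxa : x ^ (b + 1) = (n : ℝ) ^ b) :
    n.factorial * (Real.exp (-(2 * x ^ 2 / n)) ^ b * (Real.exp (x - 2) / x) ^ (b + 1)) ≤
      (qseq (b + 1) n : ℝ) := by
  set s := ⌊x⌋₊
  have hs1 : 1 ≤ s := Nat.le_floor (by simpa using hx)
  have hs1' : (1 : ℝ) ≤ s := by exact_mod_cast hs1
  have hsx : (s : ℝ) ≤ x := Nat.floor_le (by linarith)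
  have hsx' : x < s + 1 := Nat.lt_floor_add_one _
  have hn : (0 : ℝ) < n := by linarith
  have hsn : s ≤ n := by exact_mod_cast (by linarith : (s : ℝ) ≤ n)
  have hq : (n.choose s : ℝ) ^ (b + 1) * (n - s).factorial ≤ (qseq (b + 1) n : ℝ) := by
    rw [qseq_eq]
    exact single_le_sum (f := fun k ↦ (n.choose k : ℝ) ^ (b + 1) * (n - k).factorial)
      (fun k _ ↦ by positivity) (mem_range.2 (by omega))
  have hd : (n : ℝ) ^ s * Real.exp (-(2 * x ^ 2 / n)) ≤ n.descFactorial s := by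
    have h1 : (((n + 1 - s) ^ s : ℕ) : ℝ) ≤ n.descFactorial s := by
      exact_mod_cast Nat.pow_sub_le_descFactorial n s
    have h2 := exp_neg_two_mul_le (t := x / n) (by positivity)
      (by rw [div_le_iff₀ hn]; linarith)
    have h3 : ((n + 1 - s : ℕ) : ℝ) = n + 1 - s := by
      rw [Nat.cast_sub (by omega)]; push_cast; ring
    calc (n : ℝ) ^ s * Real.exp (-(2 * x ^ 2 / n))
        ≤ (n : ℝ) ^ s * Real.exp (-(2 * (x / n))) ^ s := by
          rw [← Real.exp_nat_mul]
          gcongr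
          rw [show -(2 * x ^ 2 / n) = -(x * (2 * (x / n))) by ring, mul_neg]
          gcongr
      _ ≤ (n : ℝ) ^ s * (1 - x / n) ^ s := by gcongr
      _ = (n - x) ^ s := by rw [← mul_pow]; congr 1; field_simp
      _ ≤ (n + 1 - s) ^ s := by
          gcongr
          · linarith
          · linarith
      _ ≤ _ := by rw [← h3]; exact_mod_cast h1
  have hf : Real.exp (x - 2) / x ≤ x ^ s / s.factorial := by
    have h1 := factorial_mul_exp_le hs1
    have h2 : Real.exp (x - 2) * Real.exp 1 ≤ Real.exp s := by
      rw [← Real.exp_add]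
      gcongr
      linarith
    rw [div_le_div_iff₀ (by linarith) (by positivity)]
    refine le_of_mul_le_mul_right ?_ (Real.exp_pos 1)
    calc Real.exp (x - 2) * s.factorial * Real.exp 1
        = s.factorial * (Real.exp (x - 2) * Real.exp 1) := by ring
      _ ≤ s.factorial * Real.exp s := by gcongr
      _ ≤ Real.exp 1 * (s : ℝ) ^ (s + 1) := h1
      _ ≤ Real.exp 1 * x ^ (s + 1) := by gcongr
      _ = _ := by ring
  refine le_trans ?_ hq
  rw [choose_pow_mul_factorial hsn]
  gcongr
  calc _ ≤ Real.exp (-(2 * x ^ 2 / n)) ^ b * (x ^ s / s.factorial) ^ (b + 1) := by gcongr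
    _ = ((n : ℝ) ^ s * Real.exp (-(2 * x ^ 2 / n))) ^ b / (s.factorial : ℝ) ^ (b + 1) := by
      rw [mul_pow, pow_pow_of_pow_eq hxa, div_pow]; ring
    _ ≤ _ := by gcongr

lemma re_im_of_mem_rectBoundary {x₁ x₂ Y : ℝ} (h : x₁ ≤ x₂) {z : ℂ}
    (hz : z ∈ rectBoundary x₁ x₂ Y) : z.re ≤ x₂ ∧ |z.im| ≤ Y := by
  rcases hz with ⟨h1, h2⟩ | ⟨h1 | h1, h2⟩
  · rw [Set.uIcc_of_le h] at h1
    exact ⟨h1.2, h2.le⟩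
  · exact ⟨by linarith, h2⟩
  · exact ⟨h1.le, h2⟩

lemma exists_abs_pseq2_sub_le {a : ℕ} (ha : 3 ≤ a) : ∃ X : ℝ, ∀ (n L : ℕ) (x : ℝ), X ≤ x → 1 ≤ x →
    x ^ a = (n : ℝ) ^ (a - 1) → 27 * x ≤ L → (L : ℝ) + 1 / 2 ≤ n / 2 →
    |(pseq2 a n : ℝ) - (Real.eulerMascheroniConstant ^ 2 + (2 * (a : ℝ) - 1) * Real.pi ^ 2 / 6) *
      qseq a n| ≤ 200000 * (a : ℝ) ^ 2 * n ^ 3 * (n.factorial *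
        (Real.exp (1 + 9 * x ^ 2 / n) ^ (a - 1) *
          ((16 * x) ^ a * Real.exp (a * Real.cos (2 * Real.pi / a) * x)))) := by
  obtain ⟨X, hX⟩ := exists_contour ha
  refine ⟨X, fun n L x hXx hx hxa hL hLn ↦ ?_⟩
  obtain ⟨M, Y, hM, hY1, hYx, hb⟩ := hX x hXx L hL
  have hLn' : (L : ℝ) ≤ n := by linarith
  have hn : 1 ≤ n := by
    have : (1 : ℝ) ≤ n := by linarith
    exact_mod_cast this
  have hn' : (1 : ℝ) ≤ n := by exact_mod_cast hn
  have hn0 : (0 : ℝ) < n := by linarith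
  set E := Real.exp (a * Real.cos (2 * Real.pi / a) * x) with hE
  set B := (n.factorial : ℝ) * (Real.exp (1 + 9 * x ^ 2 / n) ^ (a - 1) * ((16 * x) ^ a * E)) with hB
  have hB0 : 0 ≤ B := by positivity
  have hbd : ∀ z ∈ rectBoundary ((-(M : ℤ) : ℤ) - 1 / 2)
      ((-(M : ℤ) + (M + (L + 1) : ℕ) : ℤ) - 1 / 2) Y,
      ‖weight a n z‖ * Real.exp (-(2 * Real.pi * |z.im|)) ≤ B := fun z hz ↦ by
    rw [show (((-(M : ℤ) : ℤ) : ℝ) - 1 / 2) = -(M : ℝ) - 1 / 2 by push_cast; ring,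
      show (((-(M : ℤ) + (M + (L + 1) : ℕ) : ℤ) : ℝ) - 1 / 2) = L + 1 / 2 by
        push_cast; ring] at hz
    have h1 := re_im_of_mem_rectBoundary
      (by linarith [Nat.cast_nonneg (α := ℝ) M, Nat.cast_nonneg (α := ℝ) L]) hz
    have h2 := norm_weight_le (by omega) hn (by linarith) hxa (h1.1.trans hLn) (h1.2.trans hYx)
    rw [show (3 * x) ^ 2 = 9 * x ^ 2 by ring] at h2
    calc _ ≤ n.factorial * Real.exp (1 + 9 * x ^ 2 / n) ^ (a - 1) * scaled x z ^ a *
          Real.exp (-(2 * Real.pi * |z.im|)) := by gcongr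
      _ = n.factorial * (Real.exp (1 + 9 * x ^ 2 / n) ^ (a - 1) * (scaled x z ^ a *
          Real.exp (-(2 * Real.pi * |z.im|)))) := by ring
      _ ≤ B := by
        exact mul_le_mul_of_nonneg_left (mul_le_mul_of_nonneg_left (hb z hz) (by positivity))
          (by positivity)
  have s1 := norm_sum_deriv_le (differentiable_weight a n) (-(M : ℤ)) (M + (L + 1)) hY1 hbd
  have s2 := norm_sum_deriv_deriv_le (differentiable_weight a n) (-(M : ℤ)) (M + (L + 1)) hY1 hbd
  have hNY : 2 * ((M + (L + 1) : ℕ) : ℝ) + 4 * Y ≤ 20 * n := by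
    push_cast
    linarith
  have hpi2 : Real.pi ^ 2 ≤ 10 := by nlinarith [Real.pi_lt_d2, Real.pi_pos]
  have hpi3 : Real.pi ^ 3 ≤ 32 := by nlinarith [Real.pi_lt_d2, Real.pi_pos]
  have t1 : (2 * ((M + (L + 1) : ℕ) : ℝ) + 4 * Y) * (16 * Real.pi ^ 2 * B) ≤
      20 * n * (16 * 10 * B) := by gcongr
  have t2 : (2 * ((M + (L + 1) : ℕ) : ℝ) + 4 * Y) * (128 * Real.pi ^ 3 * B) ≤
      20 * n * (128 * 32 * B) := by gcongr
  have t3 : ∑ k ∈ Ico (L + 1) (n + 1), (n.choose k : ℝ) ^ a * (n - k).factorial *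
      |errCoeff a n k| ≤ 11 * (a : ℝ) ^ 2 * n ^ 3 * B := by
    obtain ⟨b, rfl⟩ := Nat.exists_eq_add_of_le' (show 1 ≤ a by omega)
    refine (sum_tail_le hn (by linarith) hxa hL).trans ?_
    have e1 : Real.exp (-((b + 1 : ℕ) * x)) ≤ E := by
      rw [hE]
      gcongr
      have := Real.neg_one_le_cos (2 * Real.pi / ((b + 1 : ℕ) : ℝ))
      have h0 : (0 : ℝ) ≤ (b + 1 : ℕ) * x := by positivity
      nlinarith
    have e2 : (1 : ℝ) ≤ Real.exp (1 + 9 * x ^ 2 / n) ^ (b + 1 - 1) :=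
      one_le_pow₀ (Real.one_le_exp (by positivity))
    have e3 : (1 : ℝ) ≤ (16 * x) ^ (b + 1) := one_le_pow₀ (by linarith)
    rw [hB]
    gcongr
    calc _ ≤ 1 * (1 * E) := by rw [one_mul, one_mul]; exact e1
      _ ≤ _ := by gcongr
  have ha' : (3 : ℝ) ≤ a := by exact_mod_cast ha
  have hnB : n * B ≤ (a : ℝ) ^ 2 * n ^ 3 * B := by
    gcongr
    nlinarith [one_le_pow₀ hn' (n := 2), pow_le_pow_right₀ hn' (show 1 ≤ 3 by norm_num),
      sq_nonneg ((a : ℝ) - 3), pow_pos hn0 3]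
  refine (abs_pseq2_sub_le ha (by exact_mod_cast hLn') M).trans ?_
  nlinarith [mul_nonneg (by positivity : 0 ≤ (a : ℝ) ^ 2 * n ^ 3) hB0]

end real_estimates

section main_estimate

open Filter Topology

lemma exists_abs_sub_div_le {a : ℕ} (ha : 3 ≤ a) : ∃ X K : ℝ, 0 < K ∧ ∀ (n : ℕ) (x : ℝ), X ≤ x →
    1 ≤ x → x ^ a = (n : ℝ) ^ (a - 1) → x / n ≤ 1 / 60 →
    |Real.eulerMascheroniConstant ^ 2 + (2 * (a : ℝ) - 1) * Real.pi ^ 2 / 6 -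
      (pseq2 a n : ℝ) / (qseq a n : ℝ)| ≤
      K * n ^ (2 * a + 3) * Real.exp (11 * a * (x / n) * x) *
        Real.exp (a * (Real.cos (2 * Real.pi / a) - 1) * x) := by
  obtain ⟨X, hX⟩ := exists_abs_pseq2_sub_le ha
  obtain ⟨b, rfl⟩ := Nat.exists_eq_add_of_le' (show 1 ≤ a by omega)
  refine ⟨X, 200000 * ((b + 1 : ℕ) : ℝ) ^ 2 * Real.exp 1 ^ b * 16 ^ (b + 1) *
    Real.exp 2 ^ (b + 1), by positivity, fun n x hXx hx hxa hxn ↦ ?_⟩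
  have hn0 : (0 : ℝ) < n := by
    rcases Nat.eq_zero_or_pos n with rfl | h
    · rw [Nat.cast_zero, zero_pow (by omega)] at hxa
      exact absurd hxa (by positivity)
    · exact_mod_cast h
  have hx0 : 0 < x := by linarith
  rw [div_le_iff₀ hn0] at hxn
  have hL : ((⌈27 * x⌉₊ : ℕ) : ℝ) < 27 * x + 1 := Nat.ceil_lt_add_one (by linarith)
  have h1 := hX n ⌈27 * x⌉₊ x hXx hx hxa (Nat.le_ceil _) (by linarith)
  have h2 := le_qseq (b := b) hx (by linarith) hxa
  rw [Nat.add_sub_cancel] at h1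
  have hlow : 0 < n.factorial *
      (Real.exp (-(2 * x ^ 2 / n)) ^ b * (Real.exp (x - 2) / x) ^ (b + 1)) := by positivity
  have hq : (0 : ℝ) < qseq (b + 1) n := hlow.trans_le h2
  rw [abs_sub_comm, ← mul_div_cancel_right₀ (Real.eulerMascheroniConstant ^ 2 + _) hq.ne',
    ← sub_div, abs_div, abs_of_pos hq, div_le_iff₀ hq]
  refine h1.trans (le_trans ?_ (mul_le_mul_of_nonneg_left h2 (by positivity)))
  have e1 : Real.exp (1 + 9 * x ^ 2 / n) =
      Real.exp 1 * Real.exp (11 * (x / n) * x) * Real.exp (-(2 * x ^ 2 / n)) := by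
    rw [← Real.exp_add, ← Real.exp_add]
    congr 1
    ring
  have e2 : Real.exp ((b + 1 : ℕ) * Real.cos (2 * Real.pi / (b + 1 : ℕ)) * x) =
      Real.exp ((b + 1 : ℕ) * (Real.cos (2 * Real.pi / (b + 1 : ℕ)) - 1) * x) *
        Real.exp 2 ^ (b + 1) * Real.exp (x - 2) ^ (b + 1) := by
    rw [← Real.exp_nat_mul, ← Real.exp_nat_mul, ← Real.exp_add, ← Real.exp_add]
    congr 1
    ring
  have e3 : Real.exp (11 * (x / n) * x) ^ b ≤ Real.exp (11 * (b + 1 : ℕ) * (x / n) * x) := by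
    rw [← Real.exp_nat_mul, Real.exp_le_exp]
    have : 0 ≤ 11 * (x / n) * x := by positivity
    push_cast
    linarith
  have e4 : (x ^ (b + 1)) ^ 2 * (n : ℝ) ^ 3 ≤ n ^ (2 * (b + 1) + 3) := by
    rw [pow_add (n : ℝ), mul_comm 2, pow_mul]
    have : x ≤ n := by linarith
    gcongr
  rw [e1, e2, mul_pow 16 x, div_pow, mul_pow, mul_pow]
  have hxp : x ^ (b + 1) ≠ 0 := by positivity
  set C := (n.factorial : ℝ) * (200000 * ((b + 1 : ℕ) : ℝ) ^ 2 * Real.exp 1 ^ b * 16 ^ (b + 1) *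
    Real.exp 2 ^ (b + 1)) * Real.exp (-(2 * x ^ 2 / n)) ^ b * Real.exp (x - 2) ^ (b + 1) *
    Real.exp ((b + 1 : ℕ) * (Real.cos (2 * Real.pi / (b + 1 : ℕ)) - 1) * x) / x ^ (b + 1) with hC
  calc _ = C * (((x ^ (b + 1)) ^ 2 * (n : ℝ) ^ 3) * Real.exp (11 * (x / n) * x) ^ b) := by
        rw [hC]
        field_simp
    _ ≤ C * (n ^ (2 * (b + 1) + 3) * Real.exp (11 * (b + 1 : ℕ) * (x / n) * x)) := by gcongr
    _ = _ := by
        rw [hC]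
        ring

lemma eventually_rpow_div_le {c δ : ℝ} (h1 : c < 1) (hδ : 0 < δ) :
    ∀ᶠ n : ℕ in atTop, (n : ℝ) ^ c / n ≤ δ := by
  have h := ((tendsto_rpow_neg_atTop (sub_pos.2 h1)).comp
    tendsto_natCast_atTop_atTop).eventually (ge_mem_nhds hδ)
  filter_upwards [h, eventually_ge_atTop 1] with n hn hn1
  have hn1' : (0 : ℝ) < n := by exact_mod_cast hn1
  rwa [Function.comp_apply, neg_sub, Real.rpow_sub_one hn1'.ne'] at hn

lemma eventually_mul_pow_mul_exp_le {c : ℝ} (h0 : 0 < c) (h1 : c < 1) {K A ε : ℝ} (hK : 0 < K)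
    (hA : 0 ≤ A) (hε : 0 < ε) (m : ℕ) : ∀ᶠ n : ℕ in atTop,
    K * (n : ℝ) ^ m * Real.exp (A * ((n : ℝ) ^ c / n) * (n : ℝ) ^ c) ≤
      Real.exp (ε * (n : ℝ) ^ c) := by
  have hx : Tendsto (fun n : ℕ ↦ (n : ℝ) ^ c) atTop atTop :=
    (tendsto_rpow_atTop h0).comp tendsto_natCast_atTop_atTop
  have hlog := ((isLittleO_log_rpow_atTop h0).bound
    (show 0 < ε / (3 * (m + 1)) by positivity)).natCast_atTop
  have hdiv := eventually_rpow_div_le h1 (show 0 < ε / (3 * (A + 1)) by positivity)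
  filter_upwards [hx.eventually_ge_atTop (Real.log K / (ε / 3)), hlog, hdiv,
    eventually_ge_atTop 1] with n g1 g2 g3 g4
  have hn : (1 : ℝ) ≤ n := by exact_mod_cast g4
  have hxn : 0 ≤ (n : ℝ) ^ c := by positivity
  rw [div_le_iff₀ (by positivity)] at g1
  rw [Real.norm_of_nonneg (Real.log_nonneg hn), Real.norm_of_nonneg hxn] at g2
  have f2 : m * Real.log n ≤ ε / 3 * (n : ℝ) ^ c := by
    calc _ ≤ (m + 1) * (ε / (3 * (m + 1)) * (n : ℝ) ^ c) := by
          gcongr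
          linarith
      _ = _ := by field_simp
  have f3 : A * ((n : ℝ) ^ c / n) * (n : ℝ) ^ c ≤ ε / 3 * (n : ℝ) ^ c := by
    gcongr
    calc _ ≤ (A + 1) * (ε / (3 * (A + 1))) := by
          gcongr
          linarith
      _ = _ := by field_simp
  calc _ = Real.exp (Real.log K + m * Real.log n + A * ((n : ℝ) ^ c / n) * (n : ℝ) ^ c) := by
        rw [Real.exp_add, Real.exp_add, Real.exp_log hK, Real.exp_nat_mul,
          Real.exp_log (by linarith)]
    _ ≤ _ := by
        gcongr
        linarith

end main_estimate

theorem stmt_1 (a : ℕ) (ha : 3 ≤ a) :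
    ∀ ε : ℝ, 0 < ε → ∃ N : ℕ, ∀ n : ℕ, N ≤ n →
      |Real.eulerMascheroniConstant ^ 2 + (2 * (a : ℝ) - 1) * Real.pi ^ 2 / 6 -
          (pseq2 a n : ℝ) / (qseq a n : ℝ)| ≤
        Real.exp (((a : ℝ) * (Real.cos (2 * Real.pi / (a : ℝ)) - 1) + ε) *
          (n : ℝ) ^ ((1 : ℝ) - 1 / (a : ℝ))) := by
  intro ε hε
  have ha' : (3 : ℝ) ≤ a := by exact_mod_cast ha
  obtain ⟨X, K, hK, hX⟩ := exists_abs_sub_div_le ha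
  set c : ℝ := 1 - 1 / (a : ℝ) with hc
  have hinv : 1 / (a : ℝ) ≤ 1 / 3 := by gcongr
  have hinv0 : 0 < 1 / (a : ℝ) := by positivity
  have h0 : 0 < c := by linarith
  have h1 : c < 1 := by linarith
  have hx : Filter.Tendsto (fun n : ℕ ↦ (n : ℝ) ^ c) Filter.atTop Filter.atTop :=
    (tendsto_rpow_atTop h0).comp tendsto_natCast_atTop_atTop
  rw [← Filter.eventually_atTop]
  filter_upwards [hx.eventually_ge_atTop X, hx.eventually_ge_atTop 1,
    eventually_rpow_div_le h1 (show (0 : ℝ) < 1 / 60 by norm_num),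
    eventually_mul_pow_mul_exp_le h0 h1 hK (show 0 ≤ 11 * (a : ℝ) by positivity) hε (2 * a + 3)]
    with n g1 g2 g3 g4
  have hxa : ((n : ℝ) ^ c) ^ a = (n : ℝ) ^ (a - 1) := by
    rw [← Real.rpow_natCast, ← Real.rpow_mul (by positivity), ← Real.rpow_natCast,
      Nat.cast_sub (by omega), hc]
    congr 1
    push_cast
    field_simp
  refine (hX n _ g1 g2 hxa g3).trans ?_
  rw [add_mul, Real.exp_add, mul_comm (Real.exp _)]
  gcongr
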